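/- Let G be a connected claw-free simple graph of order n with maximum degree Δ(G) ≥ 3. Then s⁺(G) ≥ n. -/

import Mathlib

open Matrix

namespace SquareEnergy

theorem adj_isHermitian {V : Type*} [Fintype V] [DecidableEq V] (G : SimpleGraph V)
    [DecidableRel G.Adj] : (G.adjMatrix ℝ).IsHermitian :=
  ((G.adjMatrix ℝ).conjTranspose_eq_transpose_of_trivial).trans (SimpleGraph.isSymm_adjMatrix G)

/-- The eigenvalues of the adjacency matrix of `G`, as a function `V → ℝ`. -/
noncomputable def adjEig {V : Type*} [Fintype V] [DecidableEq V] (G : SimpleGraph V) : V → ℝ :=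
  letI := Classical.decRel G.Adj
  (adj_isHermitian G).eigenvalues

/-- Positive square energy `s⁺(G)`. -/
noncomputable def sPlus {V : Type*} [Fintype V] [DecidableEq V] (G : SimpleGraph V) : ℝ :=
  ∑ i, if 0 < adjEig G i then (adjEig G i) ^ 2 else 0

/-- `G` is claw-free: it has no induced subgraph isomorphic to `K_{1,3}`. -/
def ClawFree {V : Type*} (G : SimpleGraph V) : Prop :=
  IsEmpty (completeBipartiteGraph (Fin 1) (Fin 3) ↪g G)

open Filter Topology
theorem arctan_le_self {x : ℝ} (hx : 0 ≤ x) : Real.arctan x ≤ x := by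
  have hm : MonotoneOn (fun y : ℝ => y - Real.arctan y) (Set.Ici 0) := by
    apply monotoneOn_of_deriv_nonneg (convex_Ici 0)
    · fun_prop
    · have := Real.differentiable_arctan
      fun_prop
    · intro y _
      have : HasDerivAt (fun y : ℝ => y - Real.arctan y) (1 - 1 / (1 + y ^ 2)) y :=
        (hasDerivAt_id y).sub (Real.hasDerivAt_arctan y)
      rw [this.deriv, sub_nonneg, div_le_one (by positivity)]
      nlinarith [sq_nonneg y]
  have := hm (Set.mem_Ici.2 le_rfl) (Set.mem_Ici.2 hx) hx
  simp at this
  linarith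

theorem self_sub_cube_le_arctan {x : ℝ} (hx : 0 ≤ x) : x - x ^ 3 ≤ Real.arctan x := by
  have hm : MonotoneOn (fun y : ℝ => Real.arctan y - y + y ^ 3) (Set.Ici 0) := by
    apply monotoneOn_of_deriv_nonneg (convex_Ici 0)
    · fun_prop
    · have := Real.differentiable_arctan
      fun_prop
    · intro y _
      have : HasDerivAt (fun y : ℝ => Real.arctan y - y + y ^ 3)
          (1 / (1 + y ^ 2) - 1 + (3 : ℕ) * y ^ (3 - 1)) y :=
        ((Real.hasDerivAt_arctan y).sub (hasDerivAt_id y)).add (hasDerivAt_pow 3 y)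
      rw [this.deriv]
      have h1 : 0 < 1 + y ^ 2 := by positivity
      have : 1 / (1 + y ^ 2) - 1 + (3 : ℕ) * y ^ (3 - 1) =
          y ^ 2 * (2 + 3 * y ^ 2) / (1 + y ^ 2) := by
        field_simp
        push_cast
        ring
      rw [this]
      positivity
  have := hm (Set.mem_Ici.2 le_rfl) (Set.mem_Ici.2 hx) hx
  simp at this
  linarith

theorem abs_arctan_sub_self_le (x : ℝ) : |Real.arctan x - x| ≤ |x| ^ 3 := by
  rcases le_total 0 x with hx | hx
  · rw [abs_of_nonneg hx, abs_le]
    constructor <;> nlinarith [arctan_le_self hx, self_sub_cube_le_arctan hx, pow_nonneg hx 3]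
  · have hx' : 0 ≤ -x := by linarith
    have h1 := arctan_le_self hx'
    have h2 := self_sub_cube_le_arctan hx'
    have h3 := pow_nonneg hx' 3
    rw [Real.arctan_neg] at h1 h2
    rw [abs_of_nonpos hx, abs_le]
    constructor <;> linarith

theorem hasDerivAt_arctan_aux (l : ℝ) {t : ℝ} (ht : 0 < t) :
    HasDerivAt (fun t : ℝ => (t ^ 2 + l ^ 2) * Real.arctan (l / t) + l * t)
      (2 * t * Real.arctan (l / t)) t := by
  have h1 : HasDerivAt (fun t : ℝ => l / t) (-l / t ^ 2) t := by
    refine ((hasDerivAt_const t l).fun_div (hasDerivAt_id' t) ht.ne').congr_deriv ?_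
    simp
  have h2 : HasDerivAt (fun t : ℝ => t ^ 2 + l ^ 2) (2 * t) t := by
    have := (hasDerivAt_pow 2 t).add_const (l ^ 2)
    simpa using this
  have h3 : HasDerivAt (fun t : ℝ => l * t) l t := by
    have := (hasDerivAt_id t).const_mul l
    simpa using this
  have := (h2.mul h1.arctan).add h3
  refine this.congr_deriv ?_
  have h4 : t ^ 2 + l ^ 2 ≠ 0 := by positivity
  have h5 : 1 + (l / t) ^ 2 = (t ^ 2 + l ^ 2) / t ^ 2 := by field_simp
  rw [h5]
  field_simp
  ring

theorem sum_mul_abs_nonneg_of_arctan {ι : Type*} [Fintype ι] (l : ι → ℝ) (h0 : ∑ i, l i = 0)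
    (h : ∀ t : ℝ, 0 < t → ∑ i, Real.arctan (l i / t) ≤ 0) : 0 ≤ ∑ i, l i * |l i| := by
  set F : ℝ → ℝ := fun t => ∑ i, ((t ^ 2 + l i ^ 2) * Real.arctan (l i / t) + l i * t) with hF
  have hd : ∀ t : ℝ, 0 < t → HasDerivAt F (2 * t * ∑ i, Real.arctan (l i / t)) t := by
    intro t ht
    rw [Finset.mul_sum]
    exact HasDerivAt.fun_sum fun i _ => hasDerivAt_arctan_aux (l i) ht
  have hanti : AntitoneOn F (Set.Ioi 0) := by
    apply antitoneOn_of_deriv_nonpos (convex_Ioi 0)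
    · exact fun t ht => (hd t ht).continuousAt.continuousWithinAt
    · rw [interior_Ioi]
      exact fun t ht => (hd t ht).differentiableAt.differentiableWithinAt
    · rw [interior_Ioi]
      intro t ht
      rw [(hd t ht).deriv]
      have : (0 : ℝ) < t := ht
      exact mul_nonpos_of_nonneg_of_nonpos (by positivity) (h t ht)
  have hinf : Tendsto F atTop (𝓝 0) := by
    have hdiv : ∀ c : ℝ, Tendsto (fun t : ℝ => c / t) atTop (𝓝 0) :=
      fun c => tendsto_const_nhds.div_atTop tendsto_id
    have e : F =ᶠ[atTop] fun t => ∑ i, (t ^ 2 * (Real.arctan (l i / t) - l i / t) +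
        l i ^ 2 * Real.arctan (l i / t)) := by
      filter_upwards [eventually_gt_atTop 0] with t ht
      have : ∀ i, (t ^ 2 + l i ^ 2) * Real.arctan (l i / t) + l i * t =
          (t ^ 2 * (Real.arctan (l i / t) - l i / t) +
            l i ^ 2 * Real.arctan (l i / t)) + 2 * t * l i := by
        intro i
        field_simp
        ring
      simp only [hF, this]
      rw [Finset.sum_add_distrib, ← Finset.mul_sum, h0]
      simp
    refine Tendsto.congr' e.symm ?_
    rw [show (0 : ℝ) = ∑ i : ι, (0 + l i ^ 2 * 0) by simp]
    refine tendsto_finsetSum _ fun i _ => ?_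
    refine Tendsto.add ?_ (Tendsto.const_mul _ ?_)
    · refine squeeze_zero_norm' (a := fun t => |l i| ^ 3 / t) ?_ (hdiv _)
      filter_upwards [eventually_gt_atTop 0] with t ht
      rw [Real.norm_eq_abs, abs_mul, abs_of_nonneg (sq_nonneg t)]
      calc t ^ 2 * |Real.arctan (l i / t) - l i / t| ≤ t ^ 2 * |l i / t| ^ 3 := by
            gcongr
            exact abs_arctan_sub_self_le _
        _ = |l i| ^ 3 / t := by
            rw [abs_div, abs_of_pos ht]
            field_simp
    · have := (Real.continuous_arctan.tendsto 0).comp (hdiv (l i))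
      rwa [Real.arctan_zero] at this
  have hpos : ∀ s : ℝ, 0 < s → 0 ≤ F s := by
    intro s hs
    refine le_of_tendsto hinf ?_
    filter_upwards [eventually_ge_atTop s] with t ht
    exact hanti hs (lt_of_lt_of_le hs ht) ht
  have hzero : Tendsto F (𝓝[>] 0) (𝓝 (∑ i, l i * |l i| * (Real.pi / 2))) := by
    refine tendsto_finsetSum _ fun i _ => ?_
    have ht0 : Tendsto (fun t : ℝ => t) (𝓝[>] 0) (𝓝 0) :=
      tendsto_nhdsWithin_of_tendsto_nhds tendsto_id
    have hb : Tendsto (fun t : ℝ => t ^ 2 * Real.arctan (l i / t)) (𝓝[>] 0) (𝓝 0) := by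
      refine squeeze_zero_norm (a := fun t => t ^ 2 * (Real.pi / 2)) ?_ ?_
      · intro t
        rw [Real.norm_eq_abs, abs_mul, abs_of_nonneg (sq_nonneg t)]
        gcongr
        rw [abs_le]
        exact ⟨(Real.neg_pi_div_two_lt_arctan _).le, (Real.arctan_lt_pi_div_two _).le⟩
      · have := (ht0.pow 2).mul_const (Real.pi / 2)
        simpa using this
    have hc : Tendsto (fun t : ℝ => l i ^ 2 * Real.arctan (l i / t)) (𝓝[>] 0)
        (𝓝 (l i * |l i| * (Real.pi / 2))) := by
      rcases lt_trichotomy (l i) 0 with hl | hl | hl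
      · have h1 : Tendsto (fun t : ℝ => l i / t) (𝓝[>] 0) atBot := by
          simp only [div_eq_mul_inv]
          exact tendsto_inv_nhdsGT_zero.const_mul_atTop_of_neg hl
        have := ((Real.tendsto_arctan_atBot.mono_right nhdsWithin_le_nhds).comp h1).const_mul
          (l i ^ 2)
        rw [abs_of_neg hl, show l i * -l i * (Real.pi / 2) = l i ^ 2 * -(Real.pi / 2) by ring]
        exact this
      · simp [hl]
      · have h1 : Tendsto (fun t : ℝ => l i / t) (𝓝[>] 0) atTop := by
          simp only [div_eq_mul_inv]
          exact tendsto_inv_nhdsGT_zero.const_mul_atTop hl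
        have := ((Real.tendsto_arctan_atTop.mono_right nhdsWithin_le_nhds).comp h1).const_mul
          (l i ^ 2)
        rw [abs_of_pos hl, show l i * l i * (Real.pi / 2) = l i ^ 2 * (Real.pi / 2) by ring]
        exact this
    have := (hb.add hc).add (ht0.const_mul (l i))
    simp only [mul_zero, add_zero, zero_add] at this
    refine this.congr fun t => ?_
    ring
  have := ge_of_tendsto hzero (eventually_nhdsWithin_of_forall fun s hs => hpos s hs)
  rw [← Finset.sum_mul] at this
  exact nonneg_of_mul_nonneg_left this (by positivity)

theorem ofReal_add_mul_I_eq (t l : ℝ) (ht : 0 < t) :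
    (t : ℂ) + Complex.I * l = ((Real.sqrt (t ^ 2 + l ^ 2) : ℝ) : ℂ) *
      Complex.exp ((Real.arctan (l / t) : ℝ) * Complex.I) := by
  have h5 : Real.sqrt (1 + (l / t) ^ 2) = Real.sqrt (t ^ 2 + l ^ 2) / t := by
    rw [← Real.sqrt_sq ht.le, ← Real.sqrt_div (by positivity), Real.sqrt_sq ht.le]
    congr 1
    field_simp
  have h6 : 0 < Real.sqrt (t ^ 2 + l ^ 2) := Real.sqrt_pos.2 (by positivity)
  apply Complex.ext
  · rw [Complex.re_ofReal_mul, Complex.exp_ofReal_mul_I_re, Real.cos_arctan, h5]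
    simp
    field_simp
  · rw [Complex.im_ofReal_mul, Complex.exp_ofReal_mul_I_im, Real.sin_arctan, h5]
    simp
    field_simp

/-- If `∏ (t + i λ_j)` stays in the fourth quadrant for all `t > 0`, then the positive part of
`λ` carries at least half of the total square. -/
theorem sum_mul_abs_nonneg_of_prod {ι : Type*} [Fintype ι] (l : ι → ℝ) (h0 : ∑ i, l i = 0)
    (h : ∀ t : ℝ, 0 < t → 0 < (∏ i, ((t : ℂ) + Complex.I * l i)).re ∧
      (∏ i, ((t : ℂ) + Complex.I * l i)).im ≤ 0) : 0 ≤ ∑ i, l i * |l i| := by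
  apply sum_mul_abs_nonneg_of_arctan l h0
  set a : ℝ → ℝ := fun t => ∑ i, Real.arctan (l i / t) with ha
  have hprod : ∀ t : ℝ, 0 < t → ∏ i, ((t : ℂ) + Complex.I * l i) =
      ((∏ i, Real.sqrt (t ^ 2 + l i ^ 2) : ℝ) : ℂ) * Complex.exp ((a t : ℝ) * Complex.I) := by
    intro t ht
    rw [ha]
    push_cast
    rw [Finset.sum_mul, Complex.exp_sum, ← Finset.prod_mul_distrib]
    refine Finset.prod_congr rfl fun i _ => ?_
    rw [ofReal_add_mul_I_eq t (l i) ht, Complex.ofReal_arctan]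
    push_cast
    rfl
  have hcs : ∀ t : ℝ, 0 < t → 0 < Real.cos (a t) ∧ Real.sin (a t) ≤ 0 := by
    intro t ht
    obtain ⟨h1, h2⟩ := h t ht
    have hp : 0 < ∏ i, Real.sqrt (t ^ 2 + l i ^ 2) :=
      Finset.prod_pos fun i _ => Real.sqrt_pos.2 (by positivity)
    rw [hprod t ht] at h1 h2
    rw [Complex.re_ofReal_mul, Complex.exp_ofReal_mul_I_re] at h1
    rw [Complex.im_ofReal_mul, Complex.exp_ofReal_mul_I_im] at h2
    exact ⟨pos_of_mul_pos_right h1 hp.le, nonpos_of_mul_nonpos_right h2 hp⟩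
  have hcont : ContinuousOn a (Set.Ioi 0) := by
    refine continuousOn_finsetSum _ fun i _ => ?_
    exact Real.continuous_arctan.comp_continuousOn
      (continuousOn_const.div continuousOn_id fun t ht => (ne_of_gt ht))
  have hinf : Tendsto a atTop (𝓝 0) := by
    rw [show (0 : ℝ) = ∑ i : ι, Real.arctan 0 by simp]
    refine tendsto_finsetSum _ fun i _ => ?_
    exact (Real.continuous_arctan.tendsto 0).comp (tendsto_const_nhds.div_atTop tendsto_id)
  have hlt : ∀ t : ℝ, 0 < t → |a t| < Real.pi / 2 := by
    intro t ht
    by_contra hge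
    push Not at hge
    have hev : ∀ᶠ s in atTop, |a s| < Real.pi / 2 := by
      have := hinf.abs
      rw [abs_zero] at this
      exact this.eventually_lt_const (by positivity)
    obtain ⟨s, hs1, hs2⟩ := (hev.and (eventually_ge_atTop t)).exists
    have hsub : Set.Icc t s ⊆ Set.Ioi 0 := fun x hx => lt_of_lt_of_le ht hx.1
    obtain ⟨x, hx, hxe⟩ := intermediate_value_Icc' hs2 ((hcont.mono hsub).abs) ⟨hs1.le, hge⟩
    have := (hcs x (hsub hx)).1
    have hxe : |a x| = Real.pi / 2 := hxe
    rw [← Real.cos_abs, hxe, Real.cos_pi_div_two] at this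
    exact lt_irrefl _ this
  intro t ht
  by_contra hgt
  push Not at hgt
  have h1 := abs_lt.1 (hlt t ht)
  have := Real.sin_pos_of_pos_of_lt_pi hgt (by linarith [Real.pi_pos, h1.2])
  linarith [(hcs t ht).2]

set_option linter.unusedSectionVars false
set_option linter.unusedSimpArgs false
section Spectral

variable {V : Type*} [Fintype V] [DecidableEq V]

theorem sum_sq_eq_trace (M : Matrix V V ℝ) : ∑ i, ∑ j, M i j ^ 2 = (Mᵀ * M).trace := by
  simp only [trace, diag, mul_apply, transpose_apply]
  rw [Finset.sum_comm]
  simp [sq]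

/-- The orthogonal change of basis to an eigenbasis of `B`. -/
theorem exists_orthogonal_diagonal (B : Matrix V V ℝ) (hB : B.IsHermitian) :
    ∃ U : Matrix V V ℝ, Uᵀ * U = 1 ∧ U * Uᵀ = 1 ∧ Uᵀ * B * U = diagonal hB.eigenvalues := by
  refine ⟨hB.eigenvectorUnitary, ?_, ?_, ?_⟩
  · have := Unitary.coe_star_mul_self hB.eigenvectorUnitary
    simpa [star_eq_conjTranspose] using this
  · have := Unitary.coe_mul_star_self hB.eigenvectorUnitary
    simpa [star_eq_conjTranspose] using this
  · have h := hB.conjStarAlgAut_star_eigenvectorUnitary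
    simpa [star_eq_conjTranspose, Unitary.conjStarAlgAut_apply] using h

theorem sum_sq_conj (U M : Matrix V V ℝ) (hU : U * Uᵀ = 1) :
    ∑ i, ∑ j, (Uᵀ * M * U) i j ^ 2 = ∑ i, ∑ j, M i j ^ 2 := by
  rw [sum_sq_eq_trace, sum_sq_eq_trace]
  have : (Uᵀ * M * U)ᵀ * (Uᵀ * M * U) = Uᵀ * (Mᵀ * M * U) := by
    calc (Uᵀ * M * U)ᵀ * (Uᵀ * M * U) = Uᵀ * Mᵀ * (U * Uᵀ) * M * U := by
          simp [Matrix.mul_assoc, transpose_mul]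
      _ = _ := by rw [hU]; simp [Matrix.mul_assoc]
  rw [this, trace_mul_comm, Matrix.mul_assoc, hU, Matrix.mul_one]

theorem sum_sq_eq_sum_eigenvalues_sq (B : Matrix V V ℝ) (hB : B.IsHermitian) :
    ∑ i, ∑ j, B i j ^ 2 = ∑ i, hB.eigenvalues i ^ 2 := by
  obtain ⟨U, -, hU, hd⟩ := exists_orthogonal_diagonal B hB
  rw [← sum_sq_conj U B hU, hd]
  refine Finset.sum_congr rfl fun i _ => ?_
  rw [Finset.sum_eq_single i]
  · simp
  · intro j _ hj
    simp [diagonal_apply_ne' _ hj]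
  · simp

theorem half_sum_sq_le_of_sum_mul_abs_nonneg (B : Matrix V V ℝ) (hB : B.IsHermitian)
    (h : 0 ≤ ∑ i, hB.eigenvalues i * |hB.eigenvalues i|) (N : Matrix V V ℝ) (hN : N.PosSemidef) :
    (∑ i, ∑ j, B i j ^ 2) / 2 ≤ ∑ i, ∑ j, (B i j + N i j) ^ 2 := by
  obtain ⟨U, -, hU, hd⟩ := exists_orthogonal_diagonal B hB
  have hN' : (Uᵀ * N * U).PosSemidef := by
    have := hN.conjTranspose_mul_mul_same U
    simpa using this
  have h1 : ∑ i, ∑ j, (B i j + N i j) ^ 2 = ∑ i, ∑ j, ((Uᵀ * (B + N) * U) i j) ^ 2 := by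
    rw [sum_sq_conj U _ hU]
    rfl
  rw [h1, sum_sq_eq_sum_eigenvalues_sq B hB]
  have h2 : ∀ i, (hB.eigenvalues i ^ 2 + hB.eigenvalues i * |hB.eigenvalues i|) / 2 ≤
      ∑ j, ((Uᵀ * (B + N) * U) i j) ^ 2 := by
    intro i
    have h3 : ((Uᵀ * (B + N) * U) i i) ^ 2 ≤ ∑ j, ((Uᵀ * (B + N) * U) i j) ^ 2 :=
      Finset.single_le_sum (f := fun j => ((Uᵀ * (B + N) * U) i j) ^ 2)
        (fun j _ => sq_nonneg _) (Finset.mem_univ i)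
    refine le_trans ?_ h3
    rw [Matrix.mul_add, Matrix.add_mul, hd, Matrix.add_apply, diagonal_apply_eq]
    have h4 : 0 ≤ (Uᵀ * N * U) i i := hN'.diag_nonneg
    rcases le_total 0 (hB.eigenvalues i) with hl | hl
    · rw [abs_of_nonneg hl]
      nlinarith
    · rw [abs_of_nonpos hl]
      nlinarith [sq_nonneg (hB.eigenvalues i + (Uᵀ * N * U) i i)]
  calc (∑ i, hB.eigenvalues i ^ 2) / 2 ≤
      ∑ i, (hB.eigenvalues i ^ 2 + hB.eigenvalues i * |hB.eigenvalues i|) / 2 := by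
        rw [← Finset.sum_div, Finset.sum_add_distrib]
        linarith
    _ ≤ _ := Finset.sum_le_sum fun i _ => h2 i

theorem det_add_I_smul (B : Matrix V V ℝ) (hB : B.IsHermitian) (t : ℝ) :
    (diagonal (fun _ => (t : ℂ)) + Complex.I • B.map (fun x : ℝ => (x : ℂ))).det =
      ∏ i, ((t : ℂ) + Complex.I * hB.eigenvalues i) := by
  obtain ⟨U, hU', hU, hd⟩ := exists_orthogonal_diagonal B hB
  set W : Matrix V V ℂ := U.map (fun x : ℝ => (x : ℂ)) with hW
  have hm : ∀ X Y : Matrix V V ℝ, (X * Y).map (fun x : ℝ => (x : ℂ)) =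
      X.map (fun x : ℝ => (x : ℂ)) * Y.map (fun x : ℝ => (x : ℂ)) := fun X Y => by
    exact Matrix.map_mul (f := Complex.ofRealHom)
  have h1 : Wᵀ * W = 1 := by
    rw [hW, ← transpose_map, ← hm, hU']
    simp
  have h2 : Wᵀ * B.map (fun x : ℝ => (x : ℂ)) * W =
      diagonal (fun i => (hB.eigenvalues i : ℂ)) := by
    rw [hW, ← transpose_map, ← hm, ← hm, hd]
    ext i j
    by_cases h : i = j <;> simp [h]
  have h3 : Wᵀ * (diagonal (fun _ => (t : ℂ)) + Complex.I • B.map (fun x : ℝ => (x : ℂ))) * W =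
      diagonal (fun i => (t : ℂ) + Complex.I * hB.eigenvalues i) := by
    rw [Matrix.mul_add, Matrix.add_mul, Matrix.mul_smul, Matrix.smul_mul, h2]
    have : (diagonal (fun _ => (t : ℂ)) : Matrix V V ℂ) = (t : ℂ) • 1 := by
      ext i j
      by_cases h : i = j <;> simp [h]
    rw [this, Matrix.mul_smul, Matrix.smul_mul, Matrix.mul_one, h1]
    ext i j
    by_cases h : i = j <;> simp [h]
  have h4 := congrArg det h3
  rw [det_mul, det_mul, det_diagonal] at h4
  have h5 := congrArg det h1
  rw [det_mul, det_one] at h5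
  rw [← h4]
  linear_combination -(diagonal (fun _ => (t : ℂ)) +
    Complex.I • B.map (fun x : ℝ => (x : ℂ))).det * h5

theorem half_sum_sq_le_of_det (B : Matrix V V ℝ) (hB : B.IsHermitian) (h0 : B.trace = 0)
    (h : ∀ t : ℝ, 0 < t →
      0 < (diagonal (fun _ => (t : ℂ)) + Complex.I • B.map (fun x : ℝ => (x : ℂ))).det.re ∧
      (diagonal (fun _ => (t : ℂ)) + Complex.I • B.map (fun x : ℝ => (x : ℂ))).det.im ≤ 0)
    (N : Matrix V V ℝ) (hN : N.PosSemidef) :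
    (∑ i, ∑ j, B i j ^ 2) / 2 ≤ ∑ i, ∑ j, (B i j + N i j) ^ 2 := by
  refine half_sum_sq_le_of_sum_mul_abs_nonneg B hB ?_ N hN
  refine sum_mul_abs_nonneg_of_prod _ ?_ fun t ht => ?_
  · have := hB.trace_eq_sum_eigenvalues
    rw [h0] at this
    simpa using this.symm
  · rw [← det_add_I_smul B hB t]
    exact h t ht

/-- A quadratic form bound over all positive semidefinite shifts controls the positive part of the
spectrum. -/
theorem le_sum_pos_sq (B : Matrix V V ℝ) (hB : B.IsHermitian) (c : ℝ)
    (h : ∀ N : Matrix V V ℝ, N.PosSemidef → c ≤ ∑ i, ∑ j, (B i j + N i j) ^ 2) :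
    c ≤ ∑ i, (if 0 < hB.eigenvalues i then hB.eigenvalues i ^ 2 else 0) := by
  obtain ⟨U, hU', hU, hd⟩ := exists_orthogonal_diagonal B hB
  set d : V → ℝ := fun i => max (-hB.eigenvalues i) 0 with hdd
  have hD : (diagonal d).PosSemidef := PosSemidef.diagonal fun i => le_max_right _ _
  have hN : (U * diagonal d * Uᵀ).PosSemidef := by
    have := hD.mul_mul_conjTranspose_same U
    simpa using this
  refine (h _ hN).trans (le_of_eq ?_)
  have h1 : ∑ i, ∑ j, (B i j + (U * diagonal d * Uᵀ) i j) ^ 2 =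
      ∑ i, ∑ j, ((Uᵀ * (B + U * diagonal d * Uᵀ) * U) i j) ^ 2 := by
    rw [sum_sq_conj U _ hU]
    rfl
  have h2 : Uᵀ * (B + U * diagonal d * Uᵀ) * U = diagonal (fun i => hB.eigenvalues i + d i) := by
    have : Uᵀ * (U * diagonal d * Uᵀ) * U = (Uᵀ * U) * diagonal d * (Uᵀ * U) := by
      simp only [Matrix.mul_assoc]
    rw [Matrix.mul_add, Matrix.add_mul, hd, this, hU', Matrix.one_mul, Matrix.mul_one]
    simp
  rw [h1, h2]
  refine Finset.sum_congr rfl fun i _ => ?_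
  rw [Finset.sum_eq_single i]
  · rw [diagonal_apply_eq, hdd]
    split_ifs with hl
    · simp [max_eq_right (by linarith : -hB.eigenvalues i ≤ 0)]
    · simp [max_eq_left (by linarith : 0 ≤ -hB.eigenvalues i)]
  · intro j _ hj
    simp [diagonal_apply_ne' _ hj]
  · simp

end Spectral

section Determinant

variable {V : Type*} [Fintype V] [DecidableEq V]

/-- The matrix obtained from `M` by eliminating the row and column of `u`. -/
noncomputable def schur (M : Matrix V V ℂ) (u : V) : Matrix V V ℂ :=
  of fun i j => if i = u then (if j = u then M u u else 0) else
    if j = u then 0 else M i j - M i u * M u j / M u u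

theorem det_schur (M : Matrix V V ℂ) (u : V) (h : M u u ≠ 0) : (schur M u).det = M.det := by
  have h1 : (of fun i j => if i = u then M u j else M i j - M i u * M u j / M u u).det =
      M.det := by
    refine det_eq_of_forall_row_eq_smul_add_const (fun i => if i = u then 0 else -M i u / M u u) u
      (by simp) fun i j => ?_
    by_cases hi : i = u
    · subst hi
      simp
    · simp only [of_apply, if_neg hi]
      ring
  rw [← h1, ← det_transpose, ← det_transpose (of _)]
  refine det_eq_of_forall_row_eq_smul_add_const (fun j => if j = u then 0 else -M u j / M u u) u
      (by simp) fun j i => ?_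
  by_cases hi : i = u
  · by_cases hj : j = u
    · simp [schur, hi, hj]
    · simp only [schur, transpose_apply, of_apply, hi, hj, if_true, if_false]
      field_simp
      ring
  · have h2 : M i u * M u u / M u u = M i u := by field_simp
    by_cases hj : j = u
    · simp [schur, hi, hj, h2]
    · simp [schur, hi, hj, h2]

variable (G : SimpleGraph V) [DecidableRel G.Adj]

/-- `diag D + i A`, where `A` is the adjacency matrix of the subgraph induced on `S`. -/
noncomputable def cMat (S : Finset V) (D : V → ℂ) : Matrix V V ℂ :=
  of fun i j => if i = j then D i else if i ∈ S ∧ j ∈ S ∧ G.Adj i j then Complex.I else 0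

/-- `cMat` with the entries `(a, k)` and `(k, a)` shifted by `w`. -/
noncomputable def wMat (S : Finset V) (D : V → ℂ) (a k : V) (w : ℂ) : Matrix V V ℂ :=
  of fun i j => cMat G S D i j + if (i = a ∧ j = k) ∨ (i = k ∧ j = a) then w else 0

theorem cMat_symm (S : Finset V) (D : V → ℂ) (i j : V) : cMat G S D i j = cMat G S D j i := by
  simp only [cMat, of_apply]
  by_cases h : i = j
  · rw [h]
  · rw [if_neg h, if_neg (Ne.symm h)]
    simp only [G.adj_comm i j]
    congr 1
    apply propext
    tauto

theorem wMat_symm (S : Finset V) (D : V → ℂ) (a k : V) (w : ℂ) (i j : V) :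
    wMat G S D a k w i j = wMat G S D a k w j i := by
  simp only [wMat, of_apply]
  rw [cMat_symm]
  congr 2
  apply propext
  tauto

/-- The open-closed fourth quadrant. -/
def Quadrant (z : ℂ) : Prop := 0 < z.re ∧ z.im ≤ 0

/-- Elimination of a vertex with at most one neighbour. -/
theorem det_cMat_pendant (S : Finset V) (D : V → ℂ) (u v : V) (hu : u ∉ S)
    (hv : ∀ x ∈ S, G.Adj u x → x = v) (hD : D u ≠ 0) :
    (cMat G (insert u S) D).det =
      (cMat G S (fun i => if i = v ∧ i ∈ S ∧ G.Adj u v then D i + 1 / D u else D i)).det := by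
  have hd : cMat G (insert u S) D u u = D u := by simp [cMat]
  rw [← det_schur _ u (by rwa [hd])]
  congr 1
  have hcol : ∀ i, i ≠ u → cMat G (insert u S) D i u =
      if i = v ∧ i ∈ S ∧ G.Adj u v then Complex.I else 0 := by
    intro i hi
    have h0 : (i ∈ S ∧ G.Adj u i) ↔ (i = v ∧ i ∈ S ∧ G.Adj u v) := by
      constructor
      · rintro ⟨h1, h2⟩
        have := hv i h1 h2
        exact ⟨this, h1, this ▸ h2⟩
      · rintro ⟨h1, h2, h3⟩
        exact ⟨h2, h1 ▸ h3⟩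
    simp [cMat, hi, G.adj_comm i u, h0]
  ext i j
  simp only [schur, of_apply, hd]
  by_cases hi : i = u
  · subst hi
    by_cases hj : j = i
    · subst hj
      simp [cMat, hu]
    · simp [cMat, hu, hj, Ne.symm hj]
  · by_cases hj : j = u
    · subst hj
      simp [cMat, hu, hi]
    · rw [if_neg hi, if_neg hj, cMat_symm G _ _ u j, hcol i hi, hcol j hj]
      by_cases hij : i = j
      · subst hij
        simp only [cMat, of_apply, if_true]
        split_ifs
        · have := Complex.I_mul_I
          rw [this]
          ring
        · simp
      · have : ¬ ((i = v ∧ i ∈ S ∧ G.Adj u v) ∧ (j = v ∧ j ∈ S ∧ G.Adj u v)) := by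
          rintro ⟨h1, h2⟩
          exact hij (h1.1.trans h2.1.symm)
        simp only [cMat, of_apply, if_neg hij, Finset.mem_insert, hi, hj, false_or]
        by_cases h1 : i = v ∧ i ∈ S ∧ G.Adj u v
        · rw [if_neg (fun h2 => this ⟨h1, h2⟩)]
          simp
        · rw [if_neg h1]
          simp

/-- Elimination of a vertex `k` joined to `v` by an edge and to `a` by a weight `w`. -/
theorem det_wMat_step (S : Finset V) (D : V → ℂ) (a k v : V) (w : ℂ) (hk : k ∉ S) (ha : a ∈ S)
    (hvS : v ∈ S) (hva : v ≠ a) (hv : ∀ x ∈ S, G.Adj k x ↔ x = v) (hD : D k ≠ 0) :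
    (wMat G (insert k S) D a k w).det =
      (wMat G S (fun i => if i = v then D i + 1 / D k else
        if i = a then D i - w ^ 2 / D k else D i) a v (-Complex.I * w / D k)).det := by
  have hka : k ≠ a := fun h => hk (h ▸ ha)
  have hkv : k ≠ v := fun h => hk (h ▸ hvS)
  have hd : wMat G (insert k S) D a k w k k = D k := by simp [wMat, cMat, hka]
  rw [← det_schur _ k (by rwa [hd])]
  congr 1
  have hcol : ∀ i, i ≠ k → wMat G (insert k S) D a k w i k =
      if i = v then Complex.I else if i = a then w else 0 := by
    intro i hi
    simp only [wMat, cMat, of_apply, if_neg hi, Finset.mem_insert, hi, false_or, true_or, true_and,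
      eq_self_iff_true, G.adj_comm i k, false_and, or_false, and_true]
    by_cases h1 : i = v
    · subst h1
      simp [hvS, (hv i hvS).2 rfl, hva]
    · have : ¬ (i ∈ S ∧ G.Adj k i) := fun h => h1 ((hv i h.1).1 h.2)
      simp [this, h1]
  ext i j
  simp only [schur, of_apply, hd]
  by_cases hi : i = k
  · subst hi
    by_cases hj : j = i
    · subst hj
      simp [wMat, cMat, hka, hkv]
    · simp [wMat, cMat, hk, hj, Ne.symm hj, hka, hkv]
  · by_cases hj : j = k
    · subst hj
      simp [wMat, cMat, hk, hi, hka, hkv]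
    · rw [if_neg hi, if_neg hj, wMat_symm G _ _ _ _ _ k j, hcol i hi, hcol j hj]
      simp only [wMat, cMat, of_apply, Finset.mem_insert, hi, hj, false_or, and_false, false_and,
        or_false, if_false, add_zero]
      by_cases hij : i = j
      · subst hij
        by_cases h1 : i = v
        · subst h1
          simp [hva]
          ring
        · by_cases h2 : i = a
          · subst h2
            simp [hva.symm]
            ring
          · simp [h1, h2]
      · simp only [if_neg hij]
        by_cases h1 : i = v
        · subst h1
          by_cases h2 : j = a
          · subst h2
            simp [hva, Ne.symm hva]
            ring
          · simp [Ne.symm hij, h2, hva]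
        · by_cases h2 : i = a
          · subst h2
            by_cases h3 : j = v
            · subst h3
              simp [hij]
              ring
            · simp [h1, h3, Ne.symm hij]
          · simp [h1, h2]

/-- Elimination of the apex `c` of a triangle `a b c`, where `ab` carries an extra weight. -/
theorem det_wMat_apex (S : Finset V) (D : V → ℂ) (a b c : V) (w : ℂ) (hc : c ∉ S) (ha : a ∈ S)
    (hb : b ∈ S) (hab : a ≠ b) (hv : ∀ x ∈ S, G.Adj c x ↔ x = a ∨ x = b) (hD : D c ≠ 0) :
    (wMat G (insert c S) D a b w).det =
      (wMat G S (fun i => if i = a ∨ i = b then D i + 1 / D c else D i) a b (w + 1 / D c)).det := by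
  have hca : c ≠ a := fun h => hc (h ▸ ha)
  have hcb : c ≠ b := fun h => hc (h ▸ hb)
  have hd : wMat G (insert c S) D a b w c c = D c := by simp [wMat, cMat, hca, hcb]
  rw [← det_schur _ c (by rwa [hd])]
  congr 1
  have hcol : ∀ i, i ≠ c → wMat G (insert c S) D a b w i c =
      if i = a ∨ i = b then Complex.I else 0 := by
    intro i hi
    simp only [wMat, cMat, of_apply, if_neg hi, Finset.mem_insert, hi, false_or, true_or, true_and,
      eq_self_iff_true, G.adj_comm i c, hca, hcb, and_false, or_false, if_false, add_zero]
    congr 1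
    apply propext
    constructor
    · rintro ⟨h1, h2⟩
      exact (hv i h1).1 h2
    · intro h
      have : i ∈ S := by rcases h with rfl | rfl <;> assumption
      exact ⟨this, (hv i this).2 h⟩
  ext i j
  simp only [schur, of_apply, hd]
  by_cases hi : i = c
  · subst hi
    by_cases hj : j = i
    · subst hj
      simp [wMat, cMat, hca, hcb]
    · simp [wMat, cMat, hc, hj, Ne.symm hj, hca, hcb]
  · by_cases hj : j = c
    · subst hj
      simp [wMat, cMat, hc, hi, hca, hcb]
    · rw [if_neg hi, if_neg hj, wMat_symm G _ _ _ _ _ c j, hcol i hi, hcol j hj]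
      simp only [wMat, cMat, of_apply, Finset.mem_insert, hi, hj, false_or]
      by_cases hij : i = j
      · subst hij
        have h2 : ¬ ((i = a ∧ i = b) ∨ (i = b ∧ i = a)) := by
          rintro (⟨rfl, h⟩ | ⟨rfl, h⟩)
          · exact hab h
          · exact hab h.symm
        simp only [if_true, if_neg h2]
        split_ifs
        · rw [Complex.I_mul_I]
          ring
        · simp
      · simp only [if_neg hij]
        by_cases h1 : i = a
        · subst h1
          by_cases h2 : j = b
          · subst h2
            simp [hab, Ne.symm hab]
            ring
          · simp [h2, Ne.symm hij, hab]
        · by_cases h2 : i = b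
          · subst h2
            by_cases h3 : j = a
            · subst h3
              simp [hab, Ne.symm hab]
              ring
            · simp [h1, h3, Ne.symm hij]
          · simp [h1, h2]

/-- Elimination of a vertex `b` whose only neighbour is `a`, with extra weight on `ab`. -/
theorem det_wMat_pendant (S : Finset V) (D : V → ℂ) (a b : V) (w : ℂ) (hb : b ∉ S) (ha : a ∈ S)
    (hv : ∀ x ∈ S, G.Adj b x ↔ x = a) (hD : D b ≠ 0) :
    (wMat G (insert b S) D a b w).det =
      (cMat G S (fun i => if i = a then D i - (Complex.I + w) ^ 2 / D b else D i)).det := by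
  have hba : b ≠ a := fun h => hb (h ▸ ha)
  have hd : wMat G (insert b S) D a b w b b = D b := by simp [wMat, cMat, hba]
  rw [← det_schur _ b (by rwa [hd])]
  congr 1
  have hcol : ∀ i, i ≠ b → wMat G (insert b S) D a b w i b =
      if i = a then Complex.I + w else 0 := by
    intro i hi
    simp only [wMat, cMat, of_apply, if_neg hi, Finset.mem_insert, hi, false_or, true_or, true_and,
      eq_self_iff_true, G.adj_comm i b, false_and, or_false, and_true]
    by_cases h1 : i = a
    · subst h1
      simp [ha, (hv i ha).2 rfl]
    · have : ¬ (i ∈ S ∧ G.Adj b i) := fun h => h1 ((hv i h.1).1 h.2)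
      simp [this, h1]
  ext i j
  simp only [schur, of_apply, hd]
  by_cases hi : i = b
  · subst hi
    by_cases hj : j = i
    · subst hj
      simp [cMat, hba]
    · simp [cMat, hb, Ne.symm hj, hj]
  · by_cases hj : j = b
    · subst hj
      simp [cMat, hb, hi]
    · rw [if_neg hi, if_neg hj, wMat_symm G _ _ _ _ _ b j, hcol i hi, hcol j hj]
      simp only [wMat, cMat, of_apply, Finset.mem_insert, hi, hj, false_or, and_false, false_and,
        or_false, if_false, add_zero]
      by_cases hij : i = j
      · subst hij
        by_cases h1 : i = a
        · subst h1
          simp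
          ring
        · simp [h1]
      · simp only [if_neg hij]
        by_cases h1 : i = a
        · subst h1
          simp [Ne.symm hij]
        · simp [h1]

theorem wMat_zero (S : Finset V) (D : V → ℂ) (a k : V) : wMat G S D a k 0 = cMat G S D := by
  ext i j
  simp [wMat]

/-- Elimination of the two outer vertices of a triangle hanging at `a`. -/
theorem det_wMat_ear (S : Finset V) (D : V → ℂ) (a b c : V) (w : ℂ) (hb : b ∉ S) (hc : c ∉ S)
    (ha : a ∈ S) (hbc : G.Adj b c)
    (hvb : ∀ x ∈ S, G.Adj b x ↔ x = a) (hvc : ∀ x ∈ S, G.Adj c x ↔ x = a)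
    (hDc : D c ≠ 0) (hDb : D b + 1 / D c ≠ 0) :
    (wMat G (insert c (insert b S)) D a b w).det =
      (cMat G S (fun i => if i = a then
          D a + 1 / D c - (Complex.I + (w + 1 / D c)) ^ 2 / (D b + 1 / D c) else
          if i = b then D b + 1 / D c else D i)).det := by
  have hba : b ≠ a := fun h => hb (h ▸ ha)
  rw [det_wMat_apex G (insert b S) D a b c w _ (by simp [ha]) (by simp) hba.symm _ hDc,
    det_wMat_pendant G S _ a b _ hb ha hvb (by simpa using hDb)]
  · congr 2
    ext i
    by_cases h1 : i = a
    · subst h1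
      simp
    · by_cases h2 : i = b
      · subst h2
        simp [h1]
      · simp [h1, h2]
  · simp [hc, hbc.ne']
  · intro x hx
    rcases Finset.mem_insert.1 hx with rfl | hx
    · simp [hbc.symm]
    · rw [hvc x hx]
      constructor
      · exact Or.inl
      · rintro (h | h)
        · exact h
        · exact absurd (h ▸ hx) hb

theorem quadrant_det_cMat_singleton (D : V → ℂ) (a : V) (ha : Quadrant (D a))
    (hD : ∀ i, i ≠ a → 0 < (D i).re ∧ (D i).im = 0) : Quadrant (cMat G {a} D).det := by
  have h1 : cMat G {a} D = diagonal D := by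
    ext i j
    by_cases h : i = j
    · simp [cMat, h]
    · have : ¬ (i ∈ ({a} : Finset V) ∧ j ∈ ({a} : Finset V) ∧ G.Adj i j) := by
        simp only [Finset.mem_singleton]
        rintro ⟨rfl, rfl, -⟩
        exact h rfl
      simp only [cMat, of_apply, if_neg h, if_neg this, diagonal_apply_ne _ h]
  have h2 : ∏ i ∈ Finset.univ.erase a, D i = ((∏ i ∈ Finset.univ.erase a, (D i).re : ℝ) : ℂ) := by
    push_cast
    refine Finset.prod_congr rfl fun i hi => ?_
    apply Complex.ext
    · simp
    · simp [(hD i (Finset.ne_of_mem_erase hi)).2]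
  have h3 : 0 < ∏ i ∈ Finset.univ.erase a, (D i).re :=
    Finset.prod_pos fun i hi => (hD i (Finset.ne_of_mem_erase hi)).1
  rw [h1, det_diagonal, ← Finset.mul_prod_erase _ _ (Finset.mem_univ a), h2]
  unfold Quadrant
  rw [Complex.re_mul_ofReal, Complex.im_mul_ofReal]
  exact ⟨mul_pos ha.1 h3, mul_nonpos_of_nonpos_of_nonneg ha.2 h3.le⟩

end Determinant

section Bounds

variable {V : Type*} [Fintype V] [DecidableEq V] (G : SimpleGraph V) [DecidableRel G.Adj]

/-- Every positive semidefinite shift of the adjacency matrix has squared Frobenius norm at least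
`c` on the principal block `S`. -/
def Bound (S : Finset V) (c : ℝ) : Prop :=
  ∀ N : Matrix V V ℝ, N.PosSemidef → c ≤ ∑ i ∈ S, ∑ j ∈ S, (G.adjMatrix ℝ i j + N i j) ^ 2

/-- Number of neighbours of `v` in `S`. -/
def degIn (S : Finset V) (v : V) : ℕ := (S.filter (G.Adj v)).card

/-- The determinant of `diag D + i A_S` is in the fourth quadrant for all positive `D`. -/
def Quad (S : Finset V) : Prop :=
  ∀ D : V → ℝ, (∀ i, 0 < D i) → Quadrant (cMat G S (fun i => (D i : ℂ))).det

/-- `S` can be reduced to `T` by repeatedly removing vertices of degree at most one. -/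
def PeelTo (T S : Finset V) : Prop :=
  T ⊆ S ∧ ∀ U, T ⊂ U → U ⊆ S → ∃ u ∈ U, u ∉ T ∧ degIn G U u ≤ 1

theorem PeelTo.mono {T S S' : Finset V} (h : PeelTo G T S) (h1 : T ⊆ S') (h2 : S' ⊆ S) :
    PeelTo G T S' :=
  ⟨h1, fun U hU hU' => h.2 U hU (hU'.trans h2)⟩

theorem bound_of_quadrant (S : Finset V)
    (h : ∀ t : ℝ, 0 < t → Quadrant (cMat G S (fun _ => (t : ℂ))).det) :
    Bound G S ((∑ i ∈ S, degIn G S i : ℕ) / 2) := by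
  intro N hN
  set B : Matrix V V ℝ := of fun i j => if i ∈ S ∧ j ∈ S ∧ G.Adj i j then 1 else 0 with hB
  set E : Matrix V V ℝ := diagonal fun i => if i ∈ S then 1 else 0 with hE
  have hBh : B.IsHermitian := by
    ext i j
    simp only [hB, conjTranspose_apply, of_apply, star_trivial, G.adj_comm j i]
    congr 1
    apply propext
    tauto
  have hN' : (E * N * E).PosSemidef := by
    have := hN.mul_mul_conjTranspose_same E
    simpa [hE] using this
  have hENE : ∀ i j, (E * N * E) i j = if i ∈ S ∧ j ∈ S then N i j else 0 := by
    intro i j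
    rw [hE, Matrix.mul_assoc, diagonal_mul, mul_diagonal]
    by_cases hi : i ∈ S <;> by_cases hj : j ∈ S <;> simp [hi, hj]
  have key := half_sum_sq_le_of_det B hBh (by simp [trace, hB]) (fun t ht => by
    have := h t ht
    have he : cMat G S (fun _ => (t : ℂ)) = diagonal (fun _ => (t : ℂ)) +
        Complex.I • B.map (fun x : ℝ => (x : ℂ)) := by
      ext i j
      by_cases hij : i = j
      · subst hij
        simp [cMat, hB]
      · by_cases h2 : i ∈ S ∧ j ∈ S ∧ G.Adj i j
        · simp [cMat, hB, hij, h2]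
        · simp only [cMat, of_apply, if_neg hij, if_neg h2, Matrix.add_apply,
            diagonal_apply_ne _ hij, Matrix.smul_apply, map_apply, hB]
          simp
    rw [he] at this
    exact this) _ hN'
  have h1 : ∑ i, ∑ j, B i j ^ 2 = ((∑ i ∈ S, degIn G S i : ℕ) : ℝ) := by
    push_cast
    rw [← Finset.sum_filter_add_sum_filter_not Finset.univ (· ∈ S)]
    rw [show Finset.univ.filter (· ∈ S) = S by ext; simp]
    rw [add_eq_left.2]
    · refine Finset.sum_congr rfl fun i hi => ?_
      simp only [degIn, hB, of_apply, hi, true_and]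
      rw [Finset.card_filter]
      push_cast
      rw [← Finset.sum_filter_add_sum_filter_not Finset.univ (· ∈ S)]
      rw [show Finset.univ.filter (· ∈ S) = S by ext; simp]
      rw [add_eq_left.2]
      · refine Finset.sum_congr rfl fun j hj => ?_
        by_cases hij : G.Adj i j <;> simp [hij, hj]
      · refine Finset.sum_eq_zero fun j hj => ?_
        simp [(Finset.mem_filter.1 hj).2]
    · refine Finset.sum_eq_zero fun i hi => ?_
      refine Finset.sum_eq_zero fun j hj => ?_
      simp [hB, (Finset.mem_filter.1 hi).2]
  have h2 : ∑ i, ∑ j, (B i j + (E * N * E) i j) ^ 2 =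
      ∑ i ∈ S, ∑ j ∈ S, (G.adjMatrix ℝ i j + N i j) ^ 2 := by
    rw [← Finset.sum_subset (Finset.subset_univ S)]
    · refine Finset.sum_congr rfl fun i hi => ?_
      rw [← Finset.sum_subset (Finset.subset_univ S)]
      · refine Finset.sum_congr rfl fun j hj => ?_
        rw [hENE]
        simp [hB, hi, hj, SimpleGraph.adjMatrix_apply]
      · intro j _ hj
        rw [hENE]
        simp [hB, hj]
    · intro i _ hi
      refine Finset.sum_eq_zero fun j _ => ?_
      rw [hENE]
      simp [hB, hi]
  rw [h1, h2] at key
  exact key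

theorem quad_empty : Quad G ∅ := by
  intro D hD
  have h1 : cMat G ∅ (fun i => (D i : ℂ)) = diagonal (fun i => (D i : ℂ)) := by
    ext i j
    by_cases h : i = j <;> simp [cMat, h]
  rw [h1, det_diagonal, ← Complex.ofReal_prod]
  exact ⟨by rw [Complex.ofReal_re]; exact Finset.prod_pos fun i _ => hD i,
    by rw [Complex.ofReal_im]⟩

theorem degIn_le_one_iff {S : Finset V} {u : V} (h : degIn G S u ≤ 1) :
    ∃ v, ∀ x ∈ S, G.Adj u x → x = v := by
  rcases (S.filter (G.Adj u)).eq_empty_or_nonempty with h0 | ⟨v, hv⟩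
  · exact ⟨u, fun x hx hux => absurd (Finset.mem_filter.2 ⟨hx, hux⟩) (by simp [h0])⟩
  · exact ⟨v, fun x hx hux =>
      Finset.card_le_one.1 h x (Finset.mem_filter.2 ⟨hx, hux⟩) v hv⟩

theorem Quad.insert {S : Finset V} (h : Quad G S) {u v : V} (hu : u ∉ S)
    (hv : ∀ x ∈ S, G.Adj u x → x = v) : Quad G (insert u S) := by
  intro D hD
  rw [det_cMat_pendant G S _ u v hu hv (by exact_mod_cast (hD u).ne')]
  have := h (fun i => if i = v ∧ i ∈ S ∧ G.Adj u v then D i + 1 / D u else D i) (fun i => by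
    have := hD i
    have := hD u
    split_ifs <;> positivity)
  convert this using 5 with i
  split_ifs <;> simp

theorem Quad.of_peelTo {T : Finset V} (hT : Quad G T) : ∀ {S : Finset V}, PeelTo G T S →
    Quad G S := by
  intro S
  induction S using Finset.strongInduction with
  | H S ih =>
    intro h
    rcases eq_or_ne T S with rfl | hne
    · exact hT
    · obtain ⟨u, hu, huT, hdeg⟩ := h.2 S (h.1.ssubset_of_ne hne) subset_rfl
      obtain ⟨v, hv⟩ := degIn_le_one_iff G hdeg
      have h1 := ih _ (Finset.erase_ssubset hu) (h.mono G
        (fun x hx => Finset.mem_erase.2 ⟨fun e => huT (e ▸ hx), h.1 hx⟩) (Finset.erase_subset _ _))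
      have h2 := h1.insert G (v := v) (Finset.notMem_erase u S)
        fun x hx => hv x (Finset.mem_of_mem_erase hx)
      rwa [Finset.insert_erase hu] at h2

theorem Quad.bound {S : Finset V} (h : Quad G S) :
    Bound G S ((∑ i ∈ S, degIn G S i : ℕ) / 2) :=
  bound_of_quadrant G S fun t ht => h (fun _ => t) fun _ => ht

/-- The determinant of `diag D + i A_S` is in the fourth quadrant when `D` is positive away from
`a` and in the fourth quadrant at `a`. -/
def EarQuad (S : Finset V) (a : V) : Prop :=
  ∀ D : V → ℂ, (∀ i, i ≠ a → 0 < (D i).re ∧ (D i).im = 0) → Quadrant (D a) →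
    Quadrant (cMat G S D).det

theorem earQuad_singleton (a : V) : EarQuad G {a} a :=
  fun D hD ha => quadrant_det_cMat_singleton G D a ha hD

theorem EarQuad.quad {S : Finset V} {a : V} (h : EarQuad G S a) : Quad G S :=
  fun D hD => h _ (fun i _ => ⟨by simpa using hD i, by simp⟩) ⟨by simpa using hD a, by simp⟩

theorem quadrant_of_apex (d : ℂ) (x y r q : ℝ) (hq : 0 < q) (h1 : 0 ≤ (x + r) * (1 + y))
    (h2 : ((x + r) ^ 2 - (1 + y) ^ 2) < (d.re + r) * q) (hd : d.im ≤ 0) :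
    Quadrant (d + r - (Complex.I + ((x + y * Complex.I) + r)) ^ 2 / q) := by
  have hq' : (q : ℂ) ≠ 0 := by exact_mod_cast hq.ne'
  have e : d + r - (Complex.I + ((x + y * Complex.I) + r)) ^ 2 / q =
      d + ((r - ((x + r) ^ 2 - (1 + y) ^ 2) / q : ℝ) : ℂ) -
        ((2 * ((x + r) * (1 + y)) / q : ℝ) : ℂ) * Complex.I := by
    push_cast
    field_simp
    linear_combination (-(1 : ℂ) - 2 * y - y ^ 2) * Complex.I_sq
  rw [e]
  constructor
  · have := (div_lt_iff₀ hq).2 h2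
    simp only [Complex.sub_re, Complex.add_re, Complex.ofReal_re, Complex.re_ofReal_mul,
      Complex.I_re, mul_zero]
    linarith
  · have : 0 ≤ 2 * ((x + r) * (1 + y)) / q := by positivity
    simp only [Complex.sub_im, Complex.add_im, Complex.ofReal_im, Complex.im_ofReal_mul,
      Complex.I_im, mul_one]
    linarith

theorem EarQuad.insert {S : Finset V} {a b c : V} (h : EarQuad G S a) (hb : b ∉ S) (hc : c ∉ S)
    (ha : a ∈ S) (hbc : G.Adj b c) (hvb : ∀ x ∈ S, G.Adj b x ↔ x = a)
    (hvc : ∀ x ∈ S, G.Adj c x ↔ x = a) : EarQuad G (insert c (insert b S)) a := by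
  intro D hD hDa
  have hba : b ≠ a := fun h => hb (h ▸ ha)
  have hca : c ≠ a := fun h => hc (h ▸ ha)
  have hreal : ∀ i, i ≠ a → D i = (((D i).re : ℝ) : ℂ) := fun i hi =>
    Complex.ext (by simp) (by simp [(hD i hi).2])
  have hB := (hD b hba).1
  have hC := (hD c hca).1
  set β := (D b).re with hβ
  set γ := (D c).re with hγ
  have hDb : D b = (β : ℂ) := hreal b hba
  have hDc : D c = (γ : ℂ) := hreal c hca
  have hq : 0 < β + 1 / γ := by positivity
  have hq' : D b + 1 / D c = ((β + 1 / γ : ℝ) : ℂ) := by rw [hDb, hDc]; simp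
  rw [← wMat_zero G _ D a b, det_wMat_ear G S D a b c 0 hb hc ha hbc hvb hvc
    (by rw [hDc]; exact_mod_cast hC.ne') (by rw [hq']; exact_mod_cast hq.ne')]
  apply h
  · intro i hi
    simp only [if_neg hi]
    by_cases hib : i = b
    · simp only [if_pos hib, hq', Complex.ofReal_re, Complex.ofReal_im, and_true]
      exact hq
    · simp only [if_neg hib]
      exact hD i hi
  · simp only [if_true, hq']
    have hr : 0 < 1 / γ := by positivity
    have := quadrant_of_apex (D a) 0 0 (1 / γ) (β + 1 / γ) hq (by simpa using hr.le) (by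
      have := hDa.1
      nlinarith [mul_pos hr hB, mul_pos this hq]) hDa.2
    convert this using 4
    · rw [hDc]; simp
    · rw [hDc]; simp

end Bounds

section House

variable {V : Type*} [Fintype V] [DecidableEq V] (G : SimpleGraph V) [DecidableRel G.Adj]

theorem degIn_eq_one_iff {S : Finset V} {u : V} :
    degIn G S u = 1 ↔ ∃ v ∈ S, ∀ x ∈ S, G.Adj u x ↔ x = v := by
  rw [degIn, Finset.card_eq_one]
  constructor
  · rintro ⟨v, hv⟩
    have hv' : v ∈ S.filter (G.Adj u) := by rw [hv]; simp
    refine ⟨v, (Finset.mem_filter.1 hv').1, fun x hx => ?_⟩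
    have := Finset.ext_iff.1 hv x
    simpa [hx] using this
  · rintro ⟨v, hvS, hv⟩
    refine ⟨v, ?_⟩
    ext x
    simp only [Finset.mem_filter, Finset.mem_singleton]
    exact ⟨fun h => (hv x h.1).1 h.2, fun h => by subst h; exact ⟨hvS, (hv x hvS).2 rfl⟩⟩

theorem degIn_erase_of_not_adj {S : Finset V} {u k : V} (h : ¬ G.Adj u k) :
    degIn G (S.erase k) u = degIn G S u := by
  unfold degIn
  congr 1
  ext x
  simp only [Finset.mem_filter, Finset.mem_erase]
  constructor
  · tauto
  · rintro ⟨h1, h2⟩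
    exact ⟨⟨fun e => h (e ▸ h2), h1⟩, h2⟩

theorem degIn_erase_of_adj {S : Finset V} {u k : V} (hk : k ∈ S) (h : G.Adj u k) :
    degIn G (S.erase k) u + 1 = degIn G S u := by
  unfold degIn
  rw [show (S.erase k).filter (G.Adj u) = (S.filter (G.Adj u)).erase k by
    ext x; simp [and_assoc]]
  exact Finset.card_erase_add_one (Finset.mem_filter.2 ⟨hk, h⟩)

/-- Admissible states of the elimination along the path of a house: `p` is the weight at `a`, `d`
the weight at the current end `k`, and `w` the entry joining them. -/
def HouseState (t p d : ℝ) (w : ℂ) : Prop :=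
  t ≤ d ∧ ((∃ ρ : ℝ, w = ρ * Complex.I ∧ |ρ| ≤ 1) ∨
    (∃ γ : ℝ, w = γ ∧ γ ^ 2 < p * d ∧ |γ| * t ≤ 1 ∧ |γ| ≤ d))

theorem HouseState.step {t p d : ℝ} {w : ℂ} (ht : 0 < t) (hp : 0 < p) (h : HouseState t p d w) :
    ∃ q : ℝ, 0 < q ∧ (p : ℂ) - w ^ 2 / d = q ∧
      HouseState t q (t + 1 / d) (-Complex.I * w / d) := by
  obtain ⟨hd, h⟩ := h
  have hd0 : 0 < d := lt_of_lt_of_le ht hd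
  have hdc : (d : ℂ) ≠ 0 := by exact_mod_cast hd0.ne'
  have hd1 : t ≤ t + 1 / d := by
    have : 0 < 1 / d := by positivity
    linarith
  rcases h with ⟨ρ, rfl, hρ⟩ | ⟨γ, rfl, hγ, h1, h2⟩
  · refine ⟨p + ρ ^ 2 / d, by positivity, ?_, hd1, Or.inr ⟨ρ / d, ?_, ?_, ?_, ?_⟩⟩
    · push_cast
      field_simp
      linear_combination -(ρ : ℂ) ^ 2 * Complex.I_sq
    · push_cast
      field_simp
      linear_combination -(ρ : ℂ) * Complex.I_sq
    · have e : (p + ρ ^ 2 / d) * (t + 1 / d) = (ρ / d) ^ 2 + (p * (t + 1 / d) + ρ ^ 2 / d * t) := by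
        field_simp
        ring
      rw [e]
      have : 0 < p * (t + 1 / d) + ρ ^ 2 / d * t := by positivity
      linarith
    · rw [abs_div, abs_of_pos hd0, div_mul_eq_mul_div, div_le_one hd0]
      nlinarith [abs_nonneg ρ]
    · rw [abs_div, abs_of_pos hd0]
      have : |ρ| / d ≤ 1 / d := by gcongr
      linarith
  · refine ⟨p - γ ^ 2 / d, ?_, ?_, hd1, Or.inl ⟨-γ / d, ?_, ?_⟩⟩
    · rw [sub_pos, div_lt_iff₀ hd0]
      exact hγ
    · push_cast
      ring
    · push_cast
      ring
    · rw [abs_div, abs_neg, abs_of_pos hd0, div_le_one hd0]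
      exact h2

theorem HouseState.apex {t p d : ℝ} {w : ℂ} (ht : 0 < t) (hp : 0 < p) (h : HouseState t p d w) :
    Quadrant ((p : ℂ) + 1 / t - (Complex.I + (w + 1 / t)) ^ 2 / (d + 1 / t)) := by
  obtain ⟨hd, h⟩ := h
  have hd0 : 0 < d := lt_of_lt_of_le ht hd
  have hr : 0 < 1 / t := by positivity
  have hq : 0 < d + 1 / t := by positivity
  suffices H : ∃ x y : ℝ, w = x + y * Complex.I ∧ 0 ≤ (x + 1 / t) * (1 + y) ∧
      ((x + 1 / t) ^ 2 - (1 + y) ^ 2) < (p + 1 / t) * (d + 1 / t) by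
    obtain ⟨x, y, rfl, h1, h2⟩ := H
    have := quadrant_of_apex p x y (1 / t) (d + 1 / t) hq h1 (by simpa using h2) (by simp)
    push_cast at this
    exact this
  rcases h with ⟨ρ, rfl, hρ⟩ | ⟨γ, rfl, hγ, h1, h2⟩
  · refine ⟨0, ρ, by simp, ?_, ?_⟩
    · have := (abs_le.1 hρ).1
      exact mul_nonneg (by linarith) (by linarith)
    · nlinarith [mul_pos hp hd0, mul_pos hp hr, mul_pos hr hd0, sq_nonneg (1 + ρ)]
  · refine ⟨γ, 0, by simp, ?_, ?_⟩
    · have : -(1 / t) ≤ γ := by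
        rw [neg_le]
        rw [le_div_iff₀ ht]
        exact (mul_le_mul_of_nonneg_right (neg_le_abs γ) ht.le).trans h1
      exact mul_nonneg (by linarith) (by norm_num)
    · have h3 : 2 * γ ≤ p + d := by
        nlinarith [sq_nonneg (p - d), sq_nonneg (p + d - 2 * γ)]
      nlinarith [mul_le_mul_of_nonneg_left h3 hr.le]

/-- Elimination along the path joining `a` to `b` in a triangle `a b c` with an extra path. -/
theorem quadrant_det_wMat_house {t : ℝ} (ht : 0 < t) {a b c : V} (hab : G.Adj a b)
    (hac : G.Adj a c) (hbc : G.Adj b c) : ∀ (U : Finset V) (k : V) (D : V → ℝ) (w : ℂ),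
    k ∈ U → k ≠ a → k ≠ c → PeelTo G {a, b, c} U →
    (∀ u ∈ U, u ∉ ({a, b, c} : Finset V) → ¬ G.Adj a u ∧ ¬ G.Adj c u) →
    (k = b → U = {a, b, c}) → (k ≠ b → degIn G U k = 1) →
    (∀ u ∈ U, u ∉ ({a, b, c} : Finset V) → u ≠ k → degIn G U u = 2) →
    (∀ i, 0 < D i) → (∀ i ∈ U, i ≠ a → i ≠ k → D i = t) → HouseState t (D a) (D k) w →
    Quadrant (wMat G U (fun i => (D i : ℂ)) a k w).det := by
  intro U
  induction U using Finset.strongInduction with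
  | H U ih =>
  intro k D w hkU hka hkc hpeel hno hb hk1 hdeg hD hDt hst
  have hT := hpeel.1
  have haU : a ∈ U := hT (by simp)
  have hbU : b ∈ U := hT (by simp)
  have hcU : c ∈ U := hT (by simp)
  by_cases hkb : k = b
  · subst hkb
    have hU : U = insert c (insert k {a}) := by
      rw [hb rfl]
      ext x
      simp only [Finset.mem_insert, Finset.mem_singleton]
      tauto
    have hDc : D c = t := hDt c hcU hac.ne' hbc.ne'
    have hDk0 := hD k
    have hq : (D k : ℂ) + 1 / (D c : ℂ) = ((D k + 1 / t : ℝ) : ℂ) := by rw [hDc]; simp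
    rw [hU, det_wMat_ear G {a} (fun i => (D i : ℂ)) a k c w (by simpa using hab.ne')
      (by simpa using hac.ne') (by simp) hbc (by
        intro x hx
        rw [Finset.mem_singleton] at hx
        subst hx
        simpa using hab.symm) (by
        intro x hx
        rw [Finset.mem_singleton] at hx
        subst hx
        simpa using hac.symm) (by simpa using (hD c).ne')
        (by
          simp only [hq]
          exact_mod_cast (by positivity : D k + 1 / t ≠ 0))]
    apply earQuad_singleton
    · intro i hi
      simp only [if_neg hi, hq]
      split_ifs
      · simp only [Complex.ofReal_re, Complex.ofReal_im, and_true]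
        positivity
      · simpa using hD i
    · simp only [if_true, hDc]
      exact hst.apex ht (hD a)
  · have hkT : k ∉ ({a, b, c} : Finset V) := by simp [hka, hkb, hkc]
    obtain ⟨v, hvU, hv⟩ := (degIn_eq_one_iff G).1 (hk1 hkb)
    have hkv : G.Adj k v := (hv v hvU).2 rfl
    have hva : v ≠ a := by
      rintro rfl
      exact (hno k hkU hkT).1 hkv.symm
    have hvc : v ≠ c := by
      rintro rfl
      exact (hno k hkU hkT).2 hkv.symm
    have hvk : v ≠ k := hkv.ne'
    set S := U.erase k with hS
    have hUS : U = insert k S := (Finset.insert_erase hkU).symm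
    have hTS : ({a, b, c} : Finset V) ⊆ S := fun x hx =>
      Finset.mem_erase.2 ⟨fun e => hkT (e ▸ hx), hT hx⟩
    have hSU : S ⊆ U := Finset.erase_subset _ _
    have hvS : v ∈ S := Finset.mem_erase.2 ⟨hvk, hvU⟩
    rw [hUS, det_wMat_step G S (fun i => (D i : ℂ)) a k v w (Finset.notMem_erase k U)
      (hTS (by simp)) hvS hva (fun x hx => hv x (hSU hx)) (by exact_mod_cast (hD k).ne')]
    have hDv : D v = t := hDt v hvU hva hvk
    obtain ⟨q, hq0, hq, hst'⟩ := hst.step ht (hD a)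
    have hnadj : ∀ u ∈ U, u ≠ v → ¬ G.Adj u k := fun u hu huv h => huv ((hv u hu).1 h.symm)
    have hdegS : ∀ u ∈ S, u ∉ ({a, b, c} : Finset V) → u ≠ v → degIn G S u = 2 := by
      intro u hu huT huv
      rw [hS, degIn_erase_of_not_adj G (hnadj u (hSU hu) huv)]
      exact hdeg u (hSU hu) huT (Finset.ne_of_mem_erase hu)
    have := ih S (Finset.erase_ssubset hkU) v
      (fun i => if i = v then t + 1 / D k else if i = a then q else D i)
      (-Complex.I * w / D k) hvS hva hvc (hpeel.mono G hTS hSU)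
      (fun u hu => hno u (hSU hu)) (by
        intro hvb
        by_contra hne
        obtain ⟨u, hu, huT, hu1⟩ := hpeel.2 S (hTS.ssubset_of_ne (Ne.symm hne)) hSU
        have := hdegS u hu huT (by rintro rfl; exact huT (by simp [hvb]))
        omega) (by
        intro hvb
        have h2 := hdeg v hvU (by simp [hva, hvb, hvc]) hvk
        have h3 := degIn_erase_of_adj G hkU hkv.symm
        rw [← hS] at h3
        omega) hdegS (by
        intro i
        have := hD k
        have := hD i
        split_ifs <;> positivity) (by
        intro i hiS hia hiv
        simp [hia, hiv, hDt i (hSU hiS) hia (Finset.ne_of_mem_erase hiS)]) (by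
        simpa [hva.symm] using hst')
    convert this using 5 with i
    by_cases hiv : i = v
    · simp [hiv, hDv]
    · by_cases hia : i = a
      · simp only [hia, hva.symm, if_true, if_false]
        exact hq
      · simp [hia, hiv]

theorem degIn_eq_sum (S : Finset V) (u : V) :
    degIn G S u = ∑ x ∈ S, if G.Adj u x then 1 else 0 := by
  rw [degIn, Finset.card_filter]

theorem degIn_union {S T : Finset V} (h : Disjoint S T) (u : V) :
    degIn G (S ∪ T) u = degIn G S u + degIn G T u := by
  simp only [degIn_eq_sum, Finset.sum_union h]

theorem degIn_mono {S T : Finset V} (h : S ⊆ T) (u : V) : degIn G S u ≤ degIn G T u :=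
  Finset.card_le_card (Finset.filter_subset_filter _ h)

theorem degIn_pos {S : Finset V} {u x : V} (hx : x ∈ S) (h : G.Adj u x) : 0 < degIn G S u :=
  Finset.card_pos.2 ⟨x, Finset.mem_filter.2 ⟨hx, h⟩⟩

theorem degIn_eq_zero {S : Finset V} {u : V} (h : ∀ x ∈ S, ¬ G.Adj u x) : degIn G S u = 0 :=
  Finset.card_eq_zero.2 (Finset.filter_eq_empty_iff.2 fun x hx => h x hx)

theorem exists_of_degIn_pos {S : Finset V} {u : V} (h : 0 < degIn G S u) : ∃ x ∈ S, G.Adj u x := by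
  obtain ⟨x, hx⟩ := Finset.card_pos.1 h
  exact ⟨x, (Finset.mem_filter.1 hx).1, (Finset.mem_filter.1 hx).2⟩

theorem degIn_le_one {S : Finset V} {u : V}
    (h : ∀ x ∈ S, ∀ y ∈ S, G.Adj u x → G.Adj u y → x = y) : degIn G S u ≤ 1 :=
  Finset.card_le_one.2 fun x hx y hy => h x (Finset.mem_filter.1 hx).1 y (Finset.mem_filter.1 hy).1
    (Finset.mem_filter.1 hx).2 (Finset.mem_filter.1 hy).2

theorem sum_degIn_comm (S T : Finset V) :
    ∑ x ∈ S, degIn G T x = ∑ y ∈ T, degIn G S y := by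
  simp only [degIn_eq_sum]
  rw [Finset.sum_comm]
  simp only [G.adj_comm]

/-- Twice the number of edges inside `S`. -/
def edges2 (S : Finset V) : ℕ := ∑ x ∈ S, degIn G S x

theorem edges2_union {S T : Finset V} (h : Disjoint S T) :
    edges2 G (S ∪ T) = edges2 G S + edges2 G T + 2 * ∑ x ∈ S, degIn G T x := by
  have := sum_degIn_comm G S T
  simp only [edges2, degIn_union G h, Finset.sum_union h, Finset.sum_add_distrib]
  omega

theorem edges2_singleton (u : V) : edges2 G {u} = 0 := by
  simp [edges2, degIn]

theorem edges2_insert {S : Finset V} {u : V} (h : u ∉ S) :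
    edges2 G (insert u S) = edges2 G S + 2 * degIn G S u := by
  rw [Finset.insert_eq, edges2_union G (Finset.disjoint_singleton_left.2 h), edges2_singleton]
  simp

theorem even_edges2 (S : Finset V) : Even (edges2 G S) := by
  induction S using Finset.induction_on with
  | empty => simp [edges2]
  | insert u S hu ih =>
    rw [edges2_insert G hu]
    exact ih.add (even_two_mul _)

theorem even_attach {T X : Finset V} (hd : Disjoint T X) (h : ∀ u ∈ X, degIn G (T ∪ X) u = 2) :
    Even (∑ z ∈ T, degIn G X z) := by
  have h1 : ∑ u ∈ X, degIn G (T ∪ X) u = 2 * X.card := by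
    rw [Finset.sum_congr rfl h]
    simp [mul_comm]
  simp only [degIn_union G hd, Finset.sum_add_distrib] at h1
  rw [sum_degIn_comm G X T] at h1
  have := even_edges2 G X
  rw [edges2] at this
  rw [Nat.even_iff] at this ⊢
  omega

theorem Quad.bound_edges {S : Finset V} (h : Quad G S) {n : ℕ} (hn : 2 * n ≤ edges2 G S) :
    Bound G S n := by
  intro N hN
  have := h.bound G N hN
  have h2 : ((2 * n : ℕ) : ℝ) ≤ ((edges2 G S : ℕ) : ℝ) := by exact_mod_cast hn
  rw [edges2] at h2
  push_cast at h2 this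
  linarith

theorem bound_house {U : Finset V} {a b c y : V} (hab : G.Adj a b) (hac : G.Adj a c)
    (hbc : G.Adj b c) (hTU : ({a, b, c} : Finset V) ⊆ U) (hyU : y ∈ U)
    (hyT : y ∉ ({a, b, c} : Finset V)) (hay : G.Adj a y)
    (ha : ∀ u ∈ U, u ∉ ({a, b, c} : Finset V) → G.Adj a u → u = y)
    (hb : ∀ u ∈ U, u ∉ ({a, b, c} : Finset V) → ∀ v ∈ U, v ∉ ({a, b, c} : Finset V) →
      G.Adj b u → G.Adj b v → u = v)
    (hc : ∀ u ∈ U, u ∉ ({a, b, c} : Finset V) → ¬ G.Adj c u)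
    (hdeg : ∀ u ∈ U, u ∉ ({a, b, c} : Finset V) → degIn G U u = 2)
    (hb3 : 3 ≤ degIn G U b)
    (hcon : ∀ X ⊆ U \ {a, b, c}, X.Nonempty → ∃ x ∈ X, ∃ z ∈ U \ X, G.Adj x z) :
    Bound G U (U.card + 1) := by
  set T : Finset V := {a, b, c} with hT
  have haT : a ∈ T := by simp [hT]
  have hbT : b ∈ T := by simp [hT]
  have hcT : c ∈ T := by simp [hT]
  have hya : y ≠ a := fun e => hyT (e ▸ haT)
  have hyb : y ≠ b := fun e => hyT (e ▸ hbT)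
  have hyc : y ≠ c := fun e => hyT (e ▸ hcT)
  let G' : SimpleGraph V := G.deleteEdges {s(a, y)}
  have hG' : ∀ i j, G'.Adj i j ↔ G.Adj i j ∧ ¬ ((i = a ∧ j = y) ∨ (i = y ∧ j = a)) := by
    intro i j
    simp [G', SimpleGraph.deleteEdges_adj]
  let _ : DecidableRel G'.Adj := fun i j => decidable_of_iff _ (hG' i j).symm
  have hpeel : PeelTo G' T U := by
    refine ⟨hTU, fun W hW hWU => ?_⟩
    by_contra hne
    push Not at hne
    set X := W \ T with hX
    have hXW : X ⊆ W := Finset.sdiff_subset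
    have hsub : ∀ u ∈ X, ∀ z ∈ U, G.Adj u z → z ∈ W ∧ G'.Adj u z := by
      intro u hu z hz huz
      obtain ⟨huW, huT⟩ := Finset.mem_sdiff.1 hu
      have h1 := hne u huW huT
      have h2 := hdeg u (hWU huW) huT
      have h3 : W.filter (G'.Adj u) ⊆ U.filter (G.Adj u) := by
        intro x hx
        rw [Finset.mem_filter] at hx ⊢
        exact ⟨hWU hx.1, ((hG' _ _).1 hx.2).1⟩
      have h4 := Finset.eq_of_subset_of_card_le h3 (by
        unfold degIn at h1 h2
        omega)
      have h5 : z ∈ U.filter (G.Adj u) := Finset.mem_filter.2 ⟨hz, huz⟩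
      rw [← h4] at h5
      exact Finset.mem_filter.1 h5
    have hyX : y ∉ X := by
      intro hy
      have := ((hG' _ _).1 (hsub y hy a (hTU haT) hay.symm).2).2
      simp at this
    have hTX : T ∪ X = W := Finset.union_sdiff_of_subset hW.1
    have hdX : ∀ u ∈ X, degIn G (T ∪ X) u = 2 := by
      intro u hu
      obtain ⟨huW, huT⟩ := Finset.mem_sdiff.1 hu
      rw [hTX, ← hdeg u (hWU huW) huT]
      unfold degIn
      congr 1
      ext z
      simp only [Finset.mem_filter]
      exact ⟨fun h => ⟨hWU h.1, h.2⟩, fun h => ⟨(hsub u hu z h.1 h.2).1, h.2⟩⟩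
    have hev := even_attach G Finset.disjoint_sdiff hdX
    have hmem : ∀ u ∈ X, u ∈ U ∧ u ∉ T := fun u hu =>
      ⟨hWU (hXW hu), (Finset.mem_sdiff.1 hu).2⟩
    have hxa : ∀ u ∈ X, ¬ G.Adj a u := by
      intro u hu h
      exact hyX (ha u (hmem u hu).1 (hmem u hu).2 h ▸ hu)
    have hxc : ∀ u ∈ X, ¬ G.Adj c u := fun u hu => hc u (hmem u hu).1 (hmem u hu).2
    have hxb : degIn G X b ≤ 1 := degIn_le_one G fun u hu v hv =>
      hb u (hmem u hu).1 (hmem u hu).2 v (hmem v hv).1 (hmem v hv).2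
    have hsum : ∑ z ∈ T, degIn G X z = degIn G X b := by
      rw [hT, Finset.sum_insert (by simp [hab.ne, hac.ne]), Finset.sum_insert (by simp [hbc.ne]),
        Finset.sum_singleton, degIn_eq_zero G hxa, degIn_eq_zero G hxc]
      omega
    rw [← hX, hsum, Nat.even_iff] at hev
    obtain ⟨x, hx, z, hz, hxz⟩ := hcon X (Finset.sdiff_subset_sdiff hWU subset_rfl)
      (Finset.sdiff_nonempty.2 hW.2)
    obtain ⟨hzU, hzX⟩ := Finset.mem_sdiff.1 hz
    have hzW := (hsub x hx z hzU hxz).1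
    have hzT : z ∈ T := by
      by_contra h
      exact hzX (Finset.mem_sdiff.2 ⟨hzW, h⟩)
    rw [hT, Finset.mem_insert, Finset.mem_insert, Finset.mem_singleton] at hzT
    rcases hzT with rfl | rfl | rfl
    · exact hxa x hx hxz.symm
    · have := degIn_pos G hx hxz.symm
      omega
    · exact hxc x hx hxz.symm
  have hquad : ∀ t : ℝ, 0 < t → Quadrant (cMat G U (fun _ => (t : ℂ))).det := by
    intro t ht
    have he : cMat G U (fun _ => (t : ℂ)) = wMat G' U (fun _ => (t : ℂ)) a y Complex.I := by
      ext i j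
      simp only [cMat, wMat, of_apply, hG']
      by_cases hij : i = j
      · subst hij
        have : ¬ ((i = a ∧ i = y) ∨ (i = y ∧ i = a)) := by
          rintro (⟨rfl, h⟩ | ⟨rfl, h⟩)
          · exact hya h.symm
          · exact hya h
        simp [this]
      · by_cases h : (i = a ∧ j = y) ∨ (i = y ∧ j = a)
        · have h2 : i ∈ U ∧ j ∈ U ∧ G.Adj i j := by
            rcases h with ⟨rfl, rfl⟩ | ⟨rfl, rfl⟩
            · exact ⟨hTU haT, hyU, hay⟩
            · exact ⟨hyU, hTU haT, hay.symm⟩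
          simp [hij, h, h2]
        · simp [hij, h]
    rw [he]
    have hG'T : ∀ i ∈ T, ∀ j ∈ T, G.Adj i j → G'.Adj i j := by
      intro i hi j hj h
      refine (hG' i j).2 ⟨h, ?_⟩
      rintro (⟨-, rfl⟩ | ⟨rfl, -⟩)
      · exact hyT hj
      · exact hyT hi
    refine quadrant_det_wMat_house G' ht (hG'T a haT b hbT hab) (hG'T a haT c hcT hac)
      (hG'T b hbT c hcT hbc) U y (fun _ => t) Complex.I hyU hya hyc hpeel ?_ ?_ ?_ ?_ ?_ ?_ ?_
    · intro u hu huT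
      refine ⟨fun h => ?_, fun h => hc u hu huT ((hG' _ _).1 h).1⟩
      have h1 := (hG' _ _).1 h
      exact h1.2 (Or.inl ⟨rfl, ha u hu huT h1.1⟩)
    · exact fun h => absurd h hyb
    · intro _
      have h1 := hdeg y hyU hyT
      have h2 := degIn_erase_of_adj G (hTU haT) hay.symm
      have h3 : degIn G' U y = degIn G (U.erase a) y := by
        unfold degIn
        congr 1
        ext z
        simp only [Finset.mem_filter, Finset.mem_erase, hG', hya, true_and, false_and, false_or]
        tauto
      omega
    · intro u hu huT huy
      rw [← hdeg u hu huT]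
      unfold degIn
      congr 1
      ext z
      have hua : u ≠ a := by rintro rfl; exact huT haT
      simp [hG', hua, huy]
    · exact fun _ => ht
    · exact fun _ _ _ _ => rfl
    · exact ⟨le_rfl, Or.inl ⟨1, by simp, by simp⟩⟩
  have hE : 2 * (U.card + 1) ≤ edges2 G U := by
    have h1 : ∀ u ∈ U, (2 + ((if u = a then 1 else 0) + (if u = b then 1 else 0))) ≤
        degIn G U u := by
      intro u hu
      by_cases huT : u ∈ T
      · rw [hT, Finset.mem_insert, Finset.mem_insert, Finset.mem_singleton] at huT
        have h2 : ∀ p q r : V, p ∈ U → q ∈ U → r ∈ U → p ≠ q → p ≠ r → q ≠ r → G.Adj u p →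
            G.Adj u q → G.Adj u r → 3 ≤ degIn G U u := by
          intro p q r hp hq hr hpq hpr hqr h1 h2 h3
          have : ({p, q, r} : Finset V) ⊆ U.filter (G.Adj u) := by
            intro z hz
            simp only [Finset.mem_insert, Finset.mem_singleton] at hz
            rcases hz with rfl | rfl | rfl <;> simp [*]
          have := Finset.card_le_card this
          rwa [Finset.card_eq_three.2 ⟨p, q, r, hpq, hpr, hqr, rfl⟩] at this
        rcases huT with rfl | rfl | rfl
        · have := h2 b c y (hTU hbT) (hTU hcT) hyU hbc.ne hyb.symm hyc.symm hab hac hay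
          simp [hab.ne, this]
        · simp [hab.ne', hb3]
        · have : ({a, b} : Finset V) ⊆ U.filter (G.Adj u) := by
            intro z hz
            simp only [Finset.mem_insert, Finset.mem_singleton] at hz
            rcases hz with rfl | rfl
            · simp [hTU haT, hac.symm]
            · simp [hTU hbT, hbc.symm]
          have := Finset.card_le_card this
          rw [Finset.card_pair hab.ne] at this
          simpa [hac.ne', hbc.ne', degIn] using this
      · have hua : u ≠ a := fun e => huT (e ▸ haT)
        have hub : u ≠ b := fun e => huT (e ▸ hbT)
        simp [hua, hub, hdeg u hu huT]
    have h2 := Finset.sum_le_sum h1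
    rw [Finset.sum_add_distrib, Finset.sum_add_distrib, Finset.sum_ite_eq', Finset.sum_ite_eq',
      if_pos (hTU haT), if_pos (hTU hbT), Finset.sum_const, smul_eq_mul] at h2
    unfold edges2
    omega
  intro N hN
  have h1 := bound_of_quadrant G U hquad N hN
  have h2 : ((2 * (U.card + 1) : ℕ) : ℝ) ≤ ((edges2 G U : ℕ) : ℝ) := by exact_mod_cast hE
  rw [edges2] at h2
  push_cast at h2 h1
  linarith

end House

section Blocks

variable {V : Type*} [Fintype V] [DecidableEq V] {G : SimpleGraph V} [DecidableRel G.Adj]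

theorem Bound.mono {S : Finset V} {c d : ℝ} (h : Bound G S c) (hd : d ≤ c) : Bound G S d :=
  fun N hN => hd.trans (h N hN)

theorem bound_zero (S : Finset V) : Bound G S 0 :=
  fun _ _ => Finset.sum_nonneg fun _ _ => Finset.sum_nonneg fun _ _ => sq_nonneg _

theorem Bound.union {S T : Finset V} {c d : ℝ} (hS : Bound G S c) (hT : Bound G T d)
    (h : Disjoint S T) : Bound G (S ∪ T) (c + d) := by
  intro N hN
  refine (add_le_add (hS N hN) (hT N hN)).trans ?_
  rw [Finset.sum_union h]
  refine add_le_add (Finset.sum_le_sum fun i _ => ?_) (Finset.sum_le_sum fun i _ => ?_)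
  · exact Finset.sum_le_sum_of_subset_of_nonneg Finset.subset_union_left fun _ _ _ => sq_nonneg _
  · exact Finset.sum_le_sum_of_subset_of_nonneg Finset.subset_union_right fun _ _ _ => sq_nonneg _

/-- A bound from an entrywise nonnegative positive semidefinite test matrix of rank two. -/
theorem bound_of_test {m : ℕ} (f : Fin m → V) (hf : Function.Injective f)
    (a : Fin m → Fin m → ℝ) (ha : ∀ i j, a i j ≤ G.adjMatrix ℝ (f i) (f j))
    (x y : Fin m → ℝ) (α β : ℝ) (hα : 0 ≤ α) (hβ : 0 ≤ β)
    (hY : ∀ i j, 0 ≤ α * (x i * x j) + β * (y i * y j)) (c : ℝ)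
    (hc : c ≤ ∑ i, ∑ j, (2 * a i j * (α * (x i * x j) + β * (y i * y j)) -
      (α * (x i * x j) + β * (y i * y j)) ^ 2)) :
    Bound G (Finset.univ.image f) c := by
  intro N hN
  have hq : ∀ z : Fin m → ℝ, 0 ≤ ∑ i, ∑ j, N (f i) (f j) * (z i * z j) := by
    intro z
    have := (hN.submatrix f).dotProduct_mulVec_nonneg z
    simp only [dotProduct, mulVec, submatrix_apply, Finset.mul_sum, star_trivial] at this
    refine this.trans (le_of_eq (Finset.sum_congr rfl fun i _ =>
      Finset.sum_congr rfl fun j _ => ?_))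
    ring
  refine hc.trans ?_
  rw [Finset.sum_image hf.injOn]
  simp only [Finset.sum_image hf.injOn]
  have h1 : 0 ≤ ∑ i, ∑ j, 2 * (N (f i) (f j) * (α * (x i * x j) + β * (y i * y j))) := by
    have e : ∑ i, ∑ j, 2 * (N (f i) (f j) * (α * (x i * x j) + β * (y i * y j))) =
        2 * α * (∑ i, ∑ j, N (f i) (f j) * (x i * x j)) +
        2 * β * (∑ i, ∑ j, N (f i) (f j) * (y i * y j)) := by
      simp only [Finset.mul_sum, ← Finset.sum_add_distrib]
      refine Finset.sum_congr rfl fun i _ => Finset.sum_congr rfl fun j _ => ?_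
      ring
    rw [e]
    have := hq x
    have := hq y
    positivity
  refine (le_add_of_nonneg_right h1).trans ?_
  rw [← Finset.sum_add_distrib]
  refine Finset.sum_le_sum fun i _ => ?_
  rw [← Finset.sum_add_distrib]
  refine Finset.sum_le_sum fun j _ => ?_
  have h2 := mul_le_mul_of_nonneg_right (ha i j) (hY i j)
  nlinarith [sq_nonneg (G.adjMatrix ℝ (f i) (f j) + N (f i) (f j) -
    (α * (x i * x j) + β * (y i * y j)))]

theorem bound_K4 {a b c d : V} (hab : G.Adj a b) (hac : G.Adj a c) (had : G.Adj a d)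
    (hbc : G.Adj b c) (hbd : G.Adj b d) (hcd : G.Adj c d) : Bound G {a, b, c, d} 9 := by
  have := bound_of_test (G := G) ![a, b, c, d] (by
    intro i j h
    fin_cases i <;> fin_cases j <;>
      simp_all [hab.ne, hac.ne, had.ne, hbc.ne, hbd.ne, hcd.ne, hab.ne', hac.ne', had.ne', hbc.ne',
        hbd.ne', hcd.ne'])
    !![0, 1, 1, 1; 1, 0, 1, 1; 1, 1, 0, 1; 1, 1, 1, 0] (by
    intro i j
    fin_cases i <;> fin_cases j <;>
      simp [hab, hac, had, hbc, hbd, hcd, hab.symm, hac.symm, had.symm, hbc.symm,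
        hbd.symm, hcd.symm])
    ![1, 1, 1, 1] ![0, 0, 0, 0] (3 / 4) 0 (by norm_num) le_rfl (by
    intro i j
    fin_cases i <;> fin_cases j <;> norm_num) 9 (by
    simp [Fin.sum_univ_four]; norm_num)
  convert this using 1
  ext z
  simp [Fin.exists_fin_succ, eq_comm]

theorem bound_diamond {a b c x : V} (hab : G.Adj a b) (hac : G.Adj a c) (hbc : G.Adj b c)
    (hax : G.Adj a x) (hbx : G.Adj b x) (hcx : c ≠ x) : Bound G {a, b, c, x} 6 := by
  have := bound_of_test (G := G) ![a, b, c, x] (by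
    intro i j h
    fin_cases i <;> fin_cases j <;>
      simp_all [hab.ne, hac.ne, hax.ne, hbc.ne, hbx.ne, hab.ne', hac.ne', hax.ne', hbc.ne',
        hbx.ne', hcx.symm])
    !![0, 1, 1, 1; 1, 0, 1, 1; 1, 1, 0, 0; 1, 1, 0, 0] (by
    intro i j
    fin_cases i <;> fin_cases j <;>
      simp [hab, hac, hax, hbc, hbx, hab.symm, hac.symm, hax.symm, hbc.symm,
        hbx.symm, SimpleGraph.adjMatrix_apply, apply_ite])
    ![1, 1, 1, 1] ![0, 0, 0, 0] (5 / 8) 0 (by norm_num) le_rfl (by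
    intro i j
    fin_cases i <;> fin_cases j <;> norm_num) 6 (by
    simp [Fin.sum_univ_four]; norm_num)
  convert this using 1
  ext z
  simp [Fin.exists_fin_succ, eq_comm]

theorem bound_gem {c a b k l : V} (hca : G.Adj c a) (hcb : G.Adj c b) (hck : G.Adj c k)
    (hcl : G.Adj c l) (hab : G.Adj a b) (hak : G.Adj a k) (hbl : G.Adj b l) (hal : a ≠ l)
    (hbk : b ≠ k) (hkl : k ≠ l) : Bound G {c, a, b, k, l} 8 := by
  have := bound_of_test (G := G) ![c, a, b, k, l] (by
    intro i j h
    fin_cases i <;> fin_cases j <;>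
      simp_all [hca.ne, hcb.ne, hck.ne, hcl.ne, hab.ne, hak.ne, hbl.ne, hca.ne', hcb.ne', hck.ne',
        hcl.ne', hab.ne', hak.ne', hbl.ne', hal.symm, hbk.symm, hkl.symm])
    !![0, 1, 1, 1, 1; 1, 0, 1, 1, 0; 1, 1, 0, 0, 1; 1, 1, 0, 0, 0; 1, 0, 1, 0, 0] (by
    intro i j
    fin_cases i <;> fin_cases j <;>
      simp [hca, hcb, hck, hcl, hab, hak, hbl, hca.symm, hcb.symm, hck.symm, hcl.symm, hab.symm,
        hak.symm, hbl.symm, SimpleGraph.adjMatrix_apply, apply_ite])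
    ![4, 3, 3, 2, 2] ![0, 0, 0, 0, 0] (61 / 882) 0 (by norm_num) le_rfl (by
    intro i j
    fin_cases i <;> fin_cases j <;> norm_num) 8 (by
    simp [Fin.sum_univ_five]; norm_num)
  convert this using 1
  ext z
  simp [Fin.exists_fin_succ, eq_comm]

theorem bound_bowtie {a b c d e : V} (hab : G.Adj a b) (hac : G.Adj a c) (had : G.Adj a d)
    (hae : G.Adj a e) (hbc : G.Adj b c) (hde : G.Adj d e) (hbd : b ≠ d) (hbe : b ≠ e)
    (hcd : c ≠ d) (hce : c ≠ e) : Bound G {a, b, c, d, e} 7 := by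
  have := bound_of_test (G := G) ![a, b, c, d, e] (by
    intro i j h
    fin_cases i <;> fin_cases j <;>
      simp_all [hab.ne, hac.ne, had.ne, hae.ne, hbc.ne, hde.ne, hab.ne', hac.ne', had.ne',
        hae.ne', hbc.ne', hde.ne', hbd.symm, hbe.symm, hcd.symm, hce.symm])
    !![0, 1, 1, 1, 1; 1, 0, 1, 0, 0; 1, 1, 0, 0, 0; 1, 0, 0, 0, 1; 1, 0, 0, 1, 0] (by
    intro i j
    fin_cases i <;> fin_cases j <;>
      simp [hab, hac, had, hae, hbc, hde, hab.symm, hac.symm, had.symm, hae.symm, hbc.symm,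
        hde.symm, SimpleGraph.adjMatrix_apply, apply_ite])
    ![3, 2, 2, 2, 2] ![0, 1, 1, -1, -1] (64 / 625) (1 / 4) (by norm_num) (by norm_num) (by
    intro i j
    fin_cases i <;> fin_cases j <;> norm_num) 7 (by
    simp [Fin.sum_univ_five]; norm_num)
  convert this using 1
  ext z
  simp [Fin.exists_fin_succ, eq_comm]

end Blocks

section Connectivity

variable {V : Type*} [Fintype V] [DecidableEq V] {G : SimpleGraph V} [DecidableRel G.Adj]

/-- The subgraph induced on `S` is connected: every proper nonempty subset of `S` is joined to its
complement in `S`. -/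
def Conn (G : SimpleGraph V) (S : Finset V) : Prop :=
  S.Nonempty ∧ ∀ U ⊆ S, U.Nonempty → (S \ U).Nonempty → ∃ u ∈ U, ∃ w ∈ S \ U, G.Adj u w

/-- At most `m` vertices of `R` dominate all vertices of `R` satisfying `p`. -/
def Dom (G : SimpleGraph V) (R : Finset V) (m : ℕ) (p : V → Prop) : Prop :=
  ∃ Y ⊆ R, Y.card ≤ m ∧ ∀ r ∈ R, p r → ∃ y ∈ Y, r = y ∨ G.Adj r y

theorem Dom.mono {R : Finset V} {m : ℕ} {p q : V → Prop} (h : Dom G R m p)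
    (hq : ∀ r ∈ R, q r → p r) : Dom G R m q := by
  obtain ⟨Y, hY, hc, hd⟩ := h
  exact ⟨Y, hY, hc, fun r hr hqr => hd r hr (hq r hr hqr)⟩

theorem Dom.or {R : Finset V} {m n : ℕ} {p q : V → Prop} (h : Dom G R m p) (h' : Dom G R n q) :
    Dom G R (m + n) (fun r => p r ∨ q r) := by
  obtain ⟨Y, hY, hc, hd⟩ := h
  obtain ⟨Z, hZ, hc', hd'⟩ := h'
  refine ⟨Y ∪ Z, Finset.union_subset hY hZ, (Finset.card_union_le _ _).trans (by omega), ?_⟩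
  rintro r hr (hp | hq)
  · obtain ⟨y, hy, h⟩ := hd r hr hp
    exact ⟨y, Finset.mem_union_left _ hy, h⟩
  · obtain ⟨y, hy, h⟩ := hd' r hr hq
    exact ⟨y, Finset.mem_union_right _ hy, h⟩

theorem dom_singleton {R : Finset V} {y : V} (hy : y ∈ R) :
    Dom G R 1 (fun r => r = y ∨ G.Adj r y) :=
  ⟨{y}, by simpa using hy, by simp, fun r _ h => ⟨y, by simp, h⟩⟩

theorem dom_clique {R : Finset V} {p : V → Prop}
    (h : ∀ r ∈ R, ∀ s ∈ R, p r → p s → r ≠ s → G.Adj r s) : Dom G R 1 p := by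
  by_cases h0 : ∃ y ∈ R, p y
  · obtain ⟨y, hy, hp⟩ := h0
    refine (dom_singleton hy).mono fun r hr hr' => ?_
    by_cases h1 : r = y
    · exact Or.inl h1
    · exact Or.inr (h r hr y hy hr' hp h1)
  · exact ⟨∅, by simp, by simp, fun r hr hp => absurd ⟨r, hr, hp⟩ h0⟩

theorem Conn.nonempty {S : Finset V} (h : Conn G S) : S.Nonempty := h.1

theorem conn_singleton (v : V) : Conn G {v} := by
  refine ⟨by simp, fun U hU hne hne' => ?_⟩
  rcases Finset.subset_singleton_iff.1 hU with rfl | rfl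
  · simp at hne
  · simp at hne'

theorem Conn.insert_adj {T : Finset V} (h : Conn G T) {t w : V} (ht : t ∈ T) (hw : G.Adj t w) :
    Conn G (insert w T) := by
  refine ⟨by simp, fun U hU hne hne' => ?_⟩
  by_cases hwU : w ∈ U
  · by_cases htU : t ∈ U
    · obtain ⟨z, hz⟩ := hne'
      have hz' : z ∈ T \ (U ∩ T) := by
        simp only [Finset.mem_sdiff, Finset.mem_insert, Finset.mem_inter] at hz ⊢
        grind
      obtain ⟨u, hu, v, hv, huv⟩ := h.2 (U ∩ T) Finset.inter_subset_right ⟨t, by simp [htU, ht]⟩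
        ⟨z, hz'⟩
      refine ⟨u, (Finset.mem_inter.1 hu).1, v, ?_, huv⟩
      simp only [Finset.mem_sdiff, Finset.mem_insert, Finset.mem_inter] at hv ⊢
      grind
    · exact ⟨w, hwU, t, by simp [ht, htU], hw.symm⟩
  · by_cases htU : t ∈ U
    · exact ⟨t, htU, w, by simp [hwU], hw⟩
    · have hUT : U ⊆ T := fun z hz => (Finset.mem_insert.1 (hU hz)).resolve_left
        (fun e => hwU (e ▸ hz))
      obtain ⟨u, hu, v, hv, huv⟩ := h.2 U hUT hne ⟨t, by simp [ht, htU]⟩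
      refine ⟨u, hu, v, ?_, huv⟩
      simp only [Finset.mem_sdiff, Finset.mem_insert] at hv ⊢
      grind

theorem conn_triangle {a b c : V} (hab : G.Adj a b) (hac : G.Adj a c) : Conn G {a, b, c} := by
  have := ((conn_singleton a).insert_adj (Finset.mem_singleton_self a) hac).insert_adj (t := a)
    (by simp) hab
  rwa [Finset.insert_comm a b, show ({a, c} : Finset V) = {c, a} from Finset.pair_comm _ _]

/-- A closed part of the complement of `D` is attached to `D`. -/
theorem Conn.exists_adj {C D U : Finset V} (hC : Conn G C) (hD : D ⊆ C) (hDn : D.Nonempty)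
    (hU : U ⊆ C \ D) (hUn : U.Nonempty) (h : ∀ u ∈ U, ∀ w ∈ (C \ D) \ U, ¬ G.Adj u w) :
    ∃ u ∈ U, ∃ d ∈ D, G.Adj u d := by
  obtain ⟨d, hd⟩ := hDn
  obtain ⟨u, hu, w, hw, huw⟩ := hC.2 U (fun z hz => (Finset.mem_sdiff.1 (hU hz)).1) hUn
    ⟨d, Finset.mem_sdiff.2 ⟨hD hd, fun h => (Finset.mem_sdiff.1 (hU h)).2 hd⟩⟩
  refine ⟨u, hu, w, ?_, huw⟩
  by_contra hwD
  simp only [Finset.mem_sdiff] at hw h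
  exact h u hu w ⟨⟨hw.1, hwD⟩, hw.2⟩ huw

theorem Conn.split {C : Finset V} (hC : Conn G C) : ∀ {T₁ T₂ : Finset V}, T₁ ⊆ C → T₂ ⊆ C →
    Disjoint T₁ T₂ → Conn G T₁ → Conn G T₂ →
    ∃ C₁ C₂, T₁ ⊆ C₁ ∧ T₂ ⊆ C₂ ∧ C₁ ∪ C₂ = C ∧ Disjoint C₁ C₂ ∧ Conn G C₁ ∧ Conn G C₂ := by
  suffices H : ∀ n (T₁ T₂ : Finset V), (C \ (T₁ ∪ T₂)).card = n → T₁ ⊆ C → T₂ ⊆ C →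
      Disjoint T₁ T₂ → Conn G T₁ → Conn G T₂ →
      ∃ C₁ C₂, T₁ ⊆ C₁ ∧ T₂ ⊆ C₂ ∧ C₁ ∪ C₂ = C ∧ Disjoint C₁ C₂ ∧ Conn G C₁ ∧ Conn G C₂ from
    fun {T₁ T₂} => H _ T₁ T₂ rfl
  intro n
  induction n with
  | zero =>
    intro T₁ T₂ hn h1 h2 hd c1 c2
    exact ⟨T₁, T₂, subset_rfl, subset_rfl, (Finset.union_subset h1 h2).antisymm
      (Finset.sdiff_eq_empty_iff_subset.1 (Finset.card_eq_zero.1 hn)), hd, c1, c2⟩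
  | succ n ih =>
    intro T₁ T₂ hn h1 h2 hd c1 c2
    obtain ⟨u, hu, w, hw, huw⟩ := hC.2 (T₁ ∪ T₂) (Finset.union_subset h1 h2)
      (c1.1.mono Finset.subset_union_left) (Finset.card_pos.1 (by omega))
    have hw' := Finset.mem_sdiff.1 hw
    have hw1 : w ∉ T₁ := fun h => hw'.2 (Finset.mem_union_left _ h)
    have hw2 : w ∉ T₂ := fun h => hw'.2 (Finset.mem_union_right _ h)
    have hcard : (C \ insert w (T₁ ∪ T₂)).card = n := by
      rw [show C \ insert w (T₁ ∪ T₂) = (C \ (T₁ ∪ T₂)).erase w by ext z; simp; tauto,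
        Finset.card_erase_of_mem hw, hn, Nat.add_sub_cancel]
    rcases Finset.mem_union.1 hu with hu | hu
    · obtain ⟨C₁, C₂, a1, a2, a3⟩ := ih (insert w T₁) T₂ (by rwa [Finset.insert_union])
        (Finset.insert_subset hw'.1 h1) h2 (Finset.disjoint_insert_left.2 ⟨hw2, hd⟩)
        (c1.insert_adj hu huw) c2
      exact ⟨C₁, C₂, (Finset.subset_insert _ _).trans a1, a2, a3⟩
    · obtain ⟨C₁, C₂, a1, a2, a3⟩ := ih T₁ (insert w T₂) (by rwa [Finset.union_insert])
        h1 (Finset.insert_subset hw'.1 h2) (Finset.disjoint_insert_right.2 ⟨hw1, hd⟩)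
        c1 (c2.insert_adj hu huw)
      exact ⟨C₁, C₂, a1, (Finset.subset_insert _ _).trans a2, a3⟩

theorem Conn.edges2_growth {C : Finset V} (hC : Conn G C) {S : Finset V} (hS : S ⊆ C)
    (hne : S.Nonempty) : edges2 G S + 2 * C.card ≤ edges2 G C + 2 * S.card := by
  suffices H : ∀ n (S : Finset V), C.card - S.card = n → S ⊆ C → S.Nonempty →
      edges2 G S + 2 * C.card ≤ edges2 G C + 2 * S.card from H _ S rfl hS hne
  intro n
  induction n with
  | zero =>
    intro S hn hS _
    rw [Finset.eq_of_subset_of_card_le hS (by omega)]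
  | succ n ih =>
    intro S hn hS hne
    obtain ⟨u, hu, w, hw, huw⟩ := hC.2 S hS hne (Finset.card_pos.1 (by
      rw [Finset.card_sdiff_of_subset hS]; omega))
    rw [Finset.mem_sdiff] at hw
    have h1 := ih (insert w S) (by rw [Finset.card_insert_of_notMem hw.2]; omega)
      (Finset.insert_subset hw.1 hS) (by simp)
    rw [Finset.card_insert_of_notMem hw.2, edges2_insert G hw.2] at h1
    have := degIn_pos G hu huw.symm
    omega

/-- A bound for a disconnected set, from bounds for its connected pieces. -/
theorem bound_of_conn {R : Finset V} (g : V → ℝ)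
    (h : ∀ K ⊆ R, Conn G K → Bound G K (K.card - 1))
    (hg : ∀ U ⊆ R, U.Nonempty → (∀ u ∈ U, ∀ w ∈ R \ U, ¬ G.Adj u w) → 1 ≤ ∑ u ∈ U, g u) :
    Bound G R (R.card - ∑ u ∈ R, g u) := by
  induction R using Finset.strongInduction with
  | H R ih =>
    rcases R.eq_empty_or_nonempty with rfl | hR
    · simpa using bound_zero (G := G) ∅
    by_cases hc : Conn G R
    · refine (h R subset_rfl hc).mono ?_
      have := hg R subset_rfl hR (by simp)
      linarith
    · simp only [Conn, hR, true_and] at hc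
      push Not at hc
      obtain ⟨U, hU, hUn, hUn', hcl⟩ := hc
      have hs : U ⊂ R := hU.ssubset_of_ne fun e => by simp [e] at hUn'
      have hs' : R \ U ⊂ R := Finset.sdiff_ssubset hU hUn
      have b1 := ih U hs (fun K hK => h K (hK.trans hU)) fun X hX hXn hXc =>
        hg X (hX.trans hU) hXn fun u hu w hw huw => by
          by_cases hwU : w ∈ U
          · exact hXc u hu w (by simp_all) huw
          · exact hcl u (hX hu) w (by simp_all) huw
      have b2 := ih (R \ U) hs' (fun K hK => h K (hK.trans hs'.1)) fun X hX hXn hXc =>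
        hg X (hX.trans hs'.1) hXn fun u hu w hw huw => by
          by_cases hwU : w ∈ U
          · exact hcl w hwU u (hX hu) huw.symm
          · exact hXc u hu w (by simp_all) huw
      have := b1.union b2 Finset.disjoint_sdiff
      rw [Finset.union_sdiff_of_subset hU] at this
      refine this.mono (le_of_eq ?_)
      rw [← Finset.sum_sdiff hU, Finset.card_sdiff_of_subset hU,
        Nat.cast_sub (Finset.card_le_card hU)]
      ring

theorem bound_of_dom {C D : Finset V} {m : ℕ} (hC : Conn G C) (hD : D ⊆ C) (hDn : D.Nonempty)
    (h : ∀ K ⊂ C, Conn G K → Bound G K (K.card - 1))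
    (hd : Dom G (C \ D) m (fun r => ∃ d ∈ D, G.Adj r d)) :
    Bound G (C \ D) ((C \ D).card - m) := by
  obtain ⟨Y, hY, hYm, hdom⟩ := hd
  have h1 := bound_of_conn (G := G) (R := C \ D) (fun u => if u ∈ Y then 1 else 0)
    (fun K hK => h K (lt_of_le_of_lt hK (Finset.sdiff_ssubset hD hDn)))
    (fun U hU hUn hUc => by
      obtain ⟨u, hu, d, hdD, hud⟩ := hC.exists_adj hD hDn hU hUn hUc
      obtain ⟨y, hy, hyu⟩ := hdom u (hU hu) ⟨d, hdD, hud⟩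
      have hyU : y ∈ U := by
        by_contra hn
        rcases hyu with rfl | hyu
        · exact hn hu
        · exact hUc u hu y (Finset.mem_sdiff.2 ⟨hY hy, hn⟩) hyu
      rw [Finset.sum_boole]
      exact_mod_cast Finset.card_pos.2 ⟨y, Finset.mem_filter.2 ⟨hyU, hy⟩⟩)
  refine h1.mono ?_
  rw [Finset.sum_boole]
  have : ((C \ D).filter (· ∈ Y)).card ≤ m :=
    (Finset.card_le_card fun z hz => (Finset.mem_filter.1 hz).2).trans hYm
  have : (((C \ D).filter (· ∈ Y)).card : ℝ) ≤ m := by exact_mod_cast this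
  linarith

/-- Combining a bound on `D` with a domination bound on its complement. -/
theorem bound_of_slack {C D : Finset V} {m : ℕ} (hC : Conn G C) (hD : D ⊆ C) (hDn : D.Nonempty)
    (h : ∀ K ⊂ C, Conn G K → Bound G K (K.card - 1))
    (hB : Bound G D (D.card + m))
    (hd : Dom G (C \ D) m (fun r => ∃ d ∈ D, G.Adj r d)) : Bound G C C.card := by
  have := hB.union (bound_of_dom hC hD hDn h hd) Finset.disjoint_sdiff
  rw [Finset.union_sdiff_of_subset hD] at this
  refine this.mono (le_of_eq ?_)
  rw [Finset.card_sdiff_of_subset hD, Nat.cast_sub (Finset.card_le_card hD)]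
  ring

end Connectivity

section Saturated

variable {V : Type*} [Fintype V] [DecidableEq V] {G : SimpleGraph V} [DecidableRel G.Adj]

/-- Among three neighbours of a vertex, two are adjacent. -/
def NoClaw (G : SimpleGraph V) : Prop :=
  ∀ v x y z, G.Adj v x → G.Adj v y → G.Adj v z → x ≠ y → y ≠ z → x ≠ z →
    G.Adj x y ∨ G.Adj y z ∨ G.Adj x z

theorem NoClaw.degIn_le_two (hG : NoClaw G) {C : Finset V} {v : V}
    (h : ∀ x ∈ C, ∀ y ∈ C, G.Adj v x → G.Adj v y → ¬ G.Adj x y) : degIn G C v ≤ 2 := by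
  by_contra hc
  obtain ⟨x, y, z, hx, hy, hz, hxy, hxz, hyz⟩ := Finset.two_lt_card_iff.1 (not_le.1 hc)
  rw [Finset.mem_filter] at hx hy hz
  rcases hG v x y z hx.2 hy.2 hz.2 hxy hyz hxz with e | e | e
  · exact h x hx.1 y hy.1 hx.2 hy.2 e
  · exact h y hy.1 z hz.1 hy.2 hz.2 e
  · exact h x hx.1 z hz.1 hx.2 hz.2 e

/-- All vertices of `X` have degree two in `C`, with both neighbours in `T ∪ X`. -/
structure Sat (G : SimpleGraph V) [DecidableRel G.Adj] (C T X : Finset V) : Prop where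
  subset : X ⊆ C
  base : T ⊆ C
  disj : Disjoint T X
  nonempty : X.Nonempty
  deg : ∀ u ∈ X, degIn G (T ∪ X) u = 2
  closed : ∀ u ∈ X, ∀ w ∈ C, G.Adj u w → w ∈ T ∪ X

theorem exists_sat {C C' T : Finset V} (hC' : C' ⊆ C) (hT : T ⊆ C')
    (hdeg : ∀ u ∈ C \ T, degIn G C u ≤ 2) (h : ¬ PeelTo G T C') : ∃ X ⊆ C', Sat G C T X := by
  simp only [PeelTo, hT, true_and] at h
  push Not at h
  obtain ⟨U, hTU, hU, hU2⟩ := h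
  have hTX : T ∪ U \ T = U := Finset.union_sdiff_of_subset hTU.1
  have key : ∀ u ∈ U \ T, degIn G U u = 2 ∧ ∀ w ∈ C, G.Adj u w → w ∈ U := by
    intro u hu
    rw [Finset.mem_sdiff] at hu
    have h1 := hU2 u hu.1 hu.2
    have h2 := hdeg u (Finset.mem_sdiff.2 ⟨hC' (hU hu.1), hu.2⟩)
    have hsub : U.filter (G.Adj u) ⊆ C.filter (G.Adj u) :=
      Finset.filter_subset_filter _ (hU.trans hC')
    have he := Finset.eq_of_subset_of_card_le hsub (by unfold degIn at h1 h2; omega)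
    refine ⟨?_, fun w hw hadj => ?_⟩
    · have := degIn_mono G (hU.trans hC') u
      omega
    · have : w ∈ U.filter (G.Adj u) := by
        rw [he]
        exact Finset.mem_filter.2 ⟨hw, hadj⟩
      exact (Finset.mem_filter.1 this).1
  refine ⟨U \ T, Finset.sdiff_subset.trans hU, Finset.sdiff_subset.trans (hU.trans hC'),
    hT.trans hC', Finset.disjoint_sdiff, Finset.sdiff_nonempty.2 hTU.2, ?_, ?_⟩
  · rw [hTX]
    exact fun u hu => (key u hu).1
  · rw [hTX]
    exact fun u hu => (key u hu).2

namespace Sat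

variable {C T X Y : Finset V}

theorem union_subset (h : Sat G C T X) : T ∪ X ⊆ C := Finset.union_subset h.base h.subset

theorem degIn_eq (h : Sat G C T X) {u : V} (hu : u ∈ X) : degIn G C u = 2 := by
  rw [← h.deg u hu]
  unfold degIn
  congr 1
  ext w
  simp only [Finset.mem_filter, and_congr_left_iff]
  exact fun hw => ⟨fun hwC => h.closed u hu w hwC hw, fun hw => h.union_subset hw⟩

theorem even (h : Sat G C T X) : Even (∑ z ∈ T, degIn G X z) := even_attach G h.disj h.deg

theorem exists_adj (h : Sat G C T X) (hC : Conn G C) (hT : T.Nonempty) :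
    ∃ u ∈ X, ∃ z ∈ T, G.Adj u z := by
  obtain ⟨t, ht⟩ := hT
  obtain ⟨u, hu, w, hw, huw⟩ := hC.2 X h.subset h.nonempty
    ⟨t, Finset.mem_sdiff.2 ⟨h.base ht, Finset.disjoint_left.1 h.disj ht⟩⟩
  rw [Finset.mem_sdiff] at hw
  exact ⟨u, hu, w, (Finset.mem_union.1 (h.closed u hu w hw.1 huw)).resolve_right hw.2, huw⟩

theorem two_le (h : Sat G C T X) (hC : Conn G C) (hT : T.Nonempty) :
    2 ≤ ∑ z ∈ T, degIn G X z := by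
  obtain ⟨u, hu, z, hz, huz⟩ := h.exists_adj hC hT
  have h1 := degIn_pos G hu huz.symm
  have h2 : degIn G X z ≤ ∑ z ∈ T, degIn G X z :=
    Finset.single_le_sum (f := fun z => degIn G X z) (fun _ _ => Nat.zero_le _) hz
  obtain ⟨k, hk⟩ := h.even
  omega

theorem edges2_eq (h : Sat G C T X) :
    edges2 G (T ∪ X) = edges2 G T + 2 * X.card + ∑ z ∈ T, degIn G X z := by
  rw [edges2_union G h.disj]
  have h1 : ∑ u ∈ X, degIn G (T ∪ X) u = 2 * X.card := by
    rw [Finset.sum_congr rfl h.deg]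
    simp [mul_comm]
  simp only [degIn_union G h.disj, Finset.sum_add_distrib] at h1
  rw [sum_degIn_comm G X T] at h1
  unfold edges2 at *
  omega

theorem union (h : Sat G C T X) (h' : Sat G C T Y) : Sat G C T (X ∪ Y) where
  subset := Finset.union_subset h.subset h'.subset
  base := h.base
  disj := Finset.disjoint_union_right.2 ⟨h.disj, h'.disj⟩
  nonempty := h.nonempty.mono Finset.subset_union_left
  deg := by
    intro u hu
    refine le_antisymm ?_ ?_
    · refine (degIn_mono G (Finset.union_subset h.base
        (Finset.union_subset h.subset h'.subset)) u).trans ?_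
      rcases Finset.mem_union.1 hu with hu | hu
      · exact (h.degIn_eq hu).le
      · exact (h'.degIn_eq hu).le
    · rcases Finset.mem_union.1 hu with hu | hu
      · rw [← h.deg u hu]
        exact degIn_mono G (Finset.union_subset_union_right Finset.subset_union_left) u
      · rw [← h'.deg u hu]
        exact degIn_mono G (Finset.union_subset_union_right Finset.subset_union_right) u
  closed := by
    intro u hu w hw huw
    rcases Finset.mem_union.1 hu with hu | hu
    · exact Finset.union_subset_union_right Finset.subset_union_left (h.closed u hu w hw huw)
    · exact Finset.union_subset_union_right Finset.subset_union_right (h'.closed u hu w hw huw)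

theorem eq_of_empty (h : Sat G C ∅ X) (hC : Conn G C) : X = C := by
  by_contra hne
  obtain ⟨u, hu, w, hw, huw⟩ := hC.2 X h.subset h.nonempty
    (Finset.sdiff_nonempty.2 fun hs => hne (h.subset.antisymm hs))
  rw [Finset.mem_sdiff] at hw
  exact hw.2 (by simpa using h.closed u hu w hw.1 huw)

end Sat

/-- Passing from vertex-deleted bounds to a bound for a 2-regular graph. -/
theorem bound_of_erase {C : Finset V} (hn2 : 2 ≤ C.card) (h2 : edges2 G C = 2 * C.card)
    (h : ∀ v ∈ C, Bound G (C.erase v) (C.card - 2)) : Bound G C (C.card - 1) := by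
  intro N hN
  set f : V → V → ℝ := fun i j => (G.adjMatrix ℝ i j + N i j) ^ 2 with hf
  change _ ≤ ∑ i ∈ C, ∑ j ∈ C, f i j
  have hsymm : ∀ i j, f i j = f j i := by
    intro i j
    have : N i j = N j i := by simpa using (hN.1.apply i j).symm
    simp only [hf, this, SimpleGraph.adjMatrix_apply, G.adj_comm]
  set n : ℝ := (C.card : ℝ) with hn
  set S := ∑ i ∈ C, ∑ j ∈ C, f i j with hS
  set a := ∑ i ∈ C, f i i with ha
  have hn1 : 2 ≤ n := by
    rw [hn]
    exact_mod_cast hn2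
  have h3 : ∀ v ∈ C, n - 2 ≤ S - 2 * (∑ j ∈ C, f v j) + f v v := by
    intro v hv
    refine (h v hv N hN).trans (le_of_eq ?_)
    change ∑ i ∈ C.erase v, ∑ j ∈ C.erase v, f i j = _
    have e1 : ∀ i, ∑ j ∈ C.erase v, f i j = ∑ j ∈ C, f i j - f i v := fun i => by
      rw [← Finset.sum_erase_add _ _ hv]
      ring
    simp only [e1, Finset.sum_sub_distrib]
    rw [hS, ← Finset.sum_erase_add (a := v) C (fun i => ∑ j ∈ C, f i j) hv]
    have e2 : ∑ j ∈ C, f v j = ∑ i ∈ C.erase v, f i v + f v v := by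
      rw [Finset.sum_erase_add _ _ hv]
      exact Finset.sum_congr rfl fun j _ => hsymm v j
    linarith
  have h4 : n * (n - 2) ≤ n * S - 2 * S + a := by
    have := Finset.sum_le_sum h3
    simp only [Finset.sum_add_distrib, Finset.sum_sub_distrib, ← Finset.mul_sum, Finset.sum_const,
      nsmul_eq_mul, ← hn, ← hS, ← ha] at this
    linarith
  by_contra hlt
  rw [not_le] at hlt
  have h5 : n - 2 ≤ a := by nlinarith
  have haS : a ≤ S := Finset.sum_le_sum fun i hi =>
    Finset.single_le_sum (f := fun j => f i j) (fun _ _ => sq_nonneg _) hi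
  have hN1 : 0 ≤ ∑ i ∈ C, ∑ j ∈ C, N i j := by
    have := hN.dotProduct_mulVec_nonneg (fun i => if i ∈ C then 1 else 0)
    simpa [dotProduct, mulVec, Finset.sum_ite_mem] using this
  have hA1 : ∑ i ∈ C, ∑ j ∈ C, G.adjMatrix ℝ i j = 2 * n := by
    have : ((edges2 G C : ℕ) : ℝ) = 2 * n := by rw [h2]; push_cast; rfl
    rw [← this, edges2]
    simp [degIn, SimpleGraph.adjMatrix_apply]
  have h6 : ∑ i ∈ C, ∑ j ∈ C, (G.adjMatrix ℝ i j + N i j) ≤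
      ∑ i ∈ C, ∑ j ∈ C, ((n * f i j + 1 / n) / 2 +
        if i = j then (f i i + 1) / 2 - (n * f i i + 1 / n) / 2 else 0) := by
    refine Finset.sum_le_sum fun i _ => Finset.sum_le_sum fun j _ => ?_
    by_cases hij : i = j
    · subst hij
      simp only [hf, if_true]
      nlinarith [sq_nonneg (G.adjMatrix ℝ i i + N i i - 1)]
    · simp only [hf, if_neg hij]
      have hn0 : 0 < n := by linarith
      have : (n * (G.adjMatrix ℝ i j + N i j) ^ 2 + 1 / n) / 2 + 0 - (G.adjMatrix ℝ i j + N i j) =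
          (n * (G.adjMatrix ℝ i j + N i j) - 1) ^ 2 / (2 * n) := by
        field_simp
        ring
      have : 0 ≤ (n * (G.adjMatrix ℝ i j + N i j) - 1) ^ 2 / (2 * n) := by positivity
      linarith
  have h7 : ∑ i ∈ C, ∑ j ∈ C, ((n * f i j + 1 / n) / 2 +
        if i = j then (f i i + 1) / 2 - (n * f i i + 1 / n) / 2 else 0) =
      (n * S + n + a + n - n * a - 1) / 2 := by
    have e1 : ∀ i ∈ C, (∑ j ∈ C, ((n * f i j + 1 / n) / 2 +
        if i = j then (f i i + 1) / 2 - (n * f i i + 1 / n) / 2 else 0)) =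
        n / 2 * (∑ j ∈ C, f i j) + 1 / 2 + ((1 - n) / 2 * f i i + (1 - 1 / n) / 2) := by
      intro i hi
      rw [Finset.sum_add_distrib, Finset.sum_ite_eq, if_pos hi, ← Finset.sum_div,
        Finset.sum_add_distrib, ← Finset.mul_sum, Finset.sum_const, nsmul_eq_mul, ← hn]
      field_simp
      ring
    rw [Finset.sum_congr rfl e1]
    simp only [Finset.sum_add_distrib, ← Finset.mul_sum, Finset.sum_const, nsmul_eq_mul, ← hn,
      ← hS, ← ha]
    field_simp
    ring
  rw [h7] at h6
  simp only [Finset.sum_add_distrib] at h6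
  nlinarith

theorem NoClaw.bound_of_triangleFree (hG : NoClaw G) {C : Finset V} (hC : Conn G C)
    (htf : ∀ x ∈ C, ∀ y ∈ C, ∀ z ∈ C, G.Adj x y → G.Adj x z → ¬ G.Adj y z) :
    Bound G C (C.card - 1) := by
  have hdeg : ∀ u ∈ C \ ∅, degIn G C u ≤ 2 := fun u hu => hG.degIn_le_two fun x hx y hy h1 h2 =>
    htf u (by simpa using hu) x hx y hy h1 h2
  have hpos : 0 < C.card := hC.nonempty.card_pos
  by_cases hp : PeelTo G ∅ C
  · have hq := Quad.of_peelTo G (quad_empty G) hp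
    obtain ⟨v, hv⟩ := hC.nonempty
    have hg := hC.edges2_growth (S := {v}) (by simpa using hv) (by simp)
    rw [edges2_singleton, Finset.card_singleton] at hg
    refine (hq.bound_edges G (n := C.card - 1) (by omega)).mono (le_of_eq ?_)
    rw [Nat.cast_sub hpos, Nat.cast_one]
  · obtain ⟨X, -, hX⟩ := exists_sat subset_rfl (Finset.empty_subset _) hdeg hp
    have hXC := hX.eq_of_empty hC
    subst hXC
    have hd : ∀ v ∈ X, degIn G X v = 2 := fun v hv => hX.degIn_eq hv
    have he : edges2 G X = 2 * X.card := by
      rw [edges2, Finset.sum_congr rfl hd]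
      simp [mul_comm]
    have h2 : 2 ≤ X.card := by
      obtain ⟨v, hv⟩ := hC.nonempty
      rw [← hd v hv]
      exact Finset.card_filter_le _ _
    refine bound_of_erase h2 he fun v hv => ?_
    have hpe : PeelTo G ∅ (X.erase v) := by
      by_contra hn
      obtain ⟨Y, hY, hYs⟩ := exists_sat (Finset.erase_subset v X) (Finset.empty_subset _) hdeg hn
      rw [hYs.eq_of_empty hC] at hY
      exact Finset.notMem_erase v X (hY hv)
    have hq := Quad.of_peelTo G (quad_empty G) hpe
    have h3 := edges2_insert G (Finset.notMem_erase v X)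
    rw [Finset.insert_erase hv, degIn_erase_of_not_adj G (G.loopless.irrefl v), hd v hv, he] at h3
    refine (hq.bound_edges G (n := X.card - 2) (by omega)).mono (le_of_eq ?_)
    rw [Nat.cast_sub h2, Nat.cast_two]

end Saturated

section Dense

variable {V : Type*} [Fintype V] [DecidableEq V] {G : SimpleGraph V} [DecidableRel G.Adj]

/-- Domination of the neighbourhoods of a vertex `v` with two nonadjacent neighbours in `R` and
of a neighbour `w` of `v`. -/
theorem NoClaw.exists_dom (hG : NoClaw G) {R : Finset V} {v k l : V} (hk : k ∈ R) (hl : l ∈ R)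
    (hvk : G.Adj v k) (hvl : G.Adj v l) (hkl : ¬ G.Adj k l) (hne : k ≠ l) :
    ∃ p : V → Prop, Dom G R 2 p ∧ (∀ r ∈ R, G.Adj r v → p r) ∧
      ∀ w ∉ R, G.Adj v w → Dom G R 1 (fun r => G.Adj r w ∧ ¬ p r) := by
  refine ⟨_, (dom_singleton hk).or (dom_singleton hl), fun r _ hrv => ?_, fun w hw hvw =>
    dom_clique ?_⟩
  · by_contra hc
    push Not at hc
    obtain ⟨⟨h1, h2⟩, h3, h4⟩ := hc
    rcases hG v k l r hvk hvl hrv.symm hne h3.symm h1.symm with h | h | h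
    · exact hkl h
    · exact h4 h.symm
    · exact h2 h.symm
  · rintro r hr s hs ⟨hrw, hr'⟩ ⟨hsw, hs'⟩ hrs
    push Not at hr' hs'
    have hwk : w ≠ k := fun h => hw (h ▸ hk)
    have hwl : w ≠ l := fun h => hw (h ▸ hl)
    rcases hG v k l w hvk hvl hvw hne hwl.symm hwk.symm with h | h | h
    · exact absurd h hkl
    · rcases hG w r s l hrw.symm hsw.symm h.symm hrs hs'.2.1 hr'.2.1 with h | h | h
      · exact h
      · exact absurd h hs'.2.2
      · exact absurd h hr'.2.2
    · rcases hG w r s k hrw.symm hsw.symm h.symm hrs hs'.1.1 hr'.1.1 with h | h | h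
      · exact h
      · exact absurd h hs'.1.2
      · exact absurd h hr'.1.2

theorem NoClaw.dom_of_K4 (hG : NoClaw G) {R : Finset V} {v k l x y z : V} (hk : k ∈ R) (hl : l ∈ R)
    (hvk : G.Adj v k) (hvl : G.Adj v l) (hkl : ¬ G.Adj k l) (hne : k ≠ l)
    (hx : x ∉ R) (hy : y ∉ R) (hz : z ∉ R) (hvx : G.Adj v x) (hvy : G.Adj v y) (hvz : G.Adj v z) :
    Dom G R 5 (fun r => G.Adj r v ∨ G.Adj r x ∨ G.Adj r y ∨ G.Adj r z) := by
  obtain ⟨p, hp, hpv, hpw⟩ := hG.exists_dom hk hl hvk hvl hkl hne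
  refine (((hp.or (hpw x hx hvx)).or (hpw y hy hvy)).or (hpw z hz hvz)).mono fun r hr h => ?_
  have := hpv r hr
  tauto

theorem NoClaw.bound_of_K4 (hG : NoClaw G) {C : Finset V} (hC : Conn G C)
    (hK : ∀ K ⊂ C, Conn G K → Bound G K (K.card - 1)) {a b c d : V} (ha : a ∈ C) (hb : b ∈ C)
    (hc : c ∈ C) (hd : d ∈ C) (hab : G.Adj a b) (hac : G.Adj a c) (had : G.Adj a d)
    (hbc : G.Adj b c) (hbd : G.Adj b d) (hcd : G.Adj c d) : Bound G C C.card := by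
  have hcard : ({a, b, c, d} : Finset V).card = 4 := by
    simp [hab.ne, hac.ne, had.ne, hbc.ne, hbd.ne, hcd.ne]
  refine bound_of_slack (D := {a, b, c, d}) (m := 5) hC (by simp [Finset.insert_subset_iff, *])
    (by simp) hK ((bound_K4 hab hac had hbc hbd hcd).mono (by rw [hcard]; norm_num)) ?_
  set R := C \ {a, b, c, d} with hR
  have haR : a ∉ R := by simp [hR]
  have hbR : b ∉ R := by simp [hR]
  have hcR : c ∉ R := by simp [hR]
  have hdR : d ∉ R := by simp [hR]
  have key : Dom G R 5 (fun r => G.Adj r a ∨ G.Adj r b ∨ G.Adj r c ∨ G.Adj r d) := by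
    by_cases h : ∃ v ∈ ({a, b, c, d} : Finset V), ∃ k ∈ R, ∃ l ∈ R,
        G.Adj v k ∧ G.Adj v l ∧ ¬ G.Adj k l ∧ k ≠ l
    · obtain ⟨v, hv, k, hk, l, hl, hvk, hvl, hkl, hne⟩ := h
      simp only [Finset.mem_insert, Finset.mem_singleton] at hv
      rcases hv with rfl | rfl | rfl | rfl
      · exact hG.dom_of_K4 hk hl hvk hvl hkl hne hbR hcR hdR hab hac had
      · exact (hG.dom_of_K4 hk hl hvk hvl hkl hne haR hcR hdR hab.symm hbc hbd).mono
          fun r _ h => by tauto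
      · exact (hG.dom_of_K4 hk hl hvk hvl hkl hne haR hbR hdR hac.symm hbc.symm hcd).mono
          fun r _ h => by tauto
      · exact (hG.dom_of_K4 hk hl hvk hvl hkl hne haR hbR hcR had.symm hbd.symm hcd.symm).mono
          fun r _ h => by tauto
    · push Not at h
      have hcl : ∀ v ∈ ({a, b, c, d} : Finset V), Dom G R 1 (fun r => G.Adj r v) := fun v hv =>
        dom_clique fun r hr s hs hrv hsv hrs => by
          by_contra hn
          exact hrs (h v hv r hr s hs hrv.symm hsv.symm hn)
      obtain ⟨Y, hY, hYc, hYd⟩ :=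
        ((hcl a (by simp)).or (hcl b (by simp))).or ((hcl c (by simp)).or (hcl d (by simp)))
      exact ⟨Y, hY, by omega, fun r hr h => hYd r hr (by tauto)⟩
  exact key.mono fun r _ h => by simpa using h

theorem NoClaw.bound_of_gem (hG : NoClaw G) {C : Finset V} (hC : Conn G C)
    (hK : ∀ K ⊂ C, Conn G K → Bound G K (K.card - 1))
    (hno : ∀ a ∈ C, ∀ b ∈ C, ∀ c ∈ C, ∀ d ∈ C, G.Adj a b → G.Adj a c → G.Adj a d → G.Adj b c →
      G.Adj b d → ¬ G.Adj c d) {a b c x k l : V} (ha : a ∈ C) (hb : b ∈ C) (hc : c ∈ C) (hx : x ∈ C)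
    (hk : k ∈ C) (hl : l ∈ C) (hab : G.Adj a b) (hca : G.Adj c a) (hcb : G.Adj c b)
    (hax : G.Adj a x) (hbx : G.Adj b x) (hcx : ¬ G.Adj c x) (hck : G.Adj c k)
    (hcl : G.Adj c l) (hkl : ¬ G.Adj k l) (hne : k ≠ l) (hak : G.Adj a k) (hbl : G.Adj b l)
    (hxc : x ≠ c) : Bound G C C.card := by
  have hal : ¬ G.Adj a l := fun h => hno a ha b hb c hc l hl hab hca.symm h hcb.symm hbl hcl
  have hbk : ¬ G.Adj b k := fun h => hno a ha b hb c hc k hk hab hca.symm hak hcb.symm h hck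
  have hxk : x ≠ k := fun h => hcx (h ▸ hck)
  have hxl : x ≠ l := fun h => hcx (h ▸ hcl)
  have hnal : a ≠ l := fun h => hkl (h ▸ hak.symm)
  have hnbk : b ≠ k := fun h => hkl (h ▸ hbl)
  have hcard : ({c, a, b, k, l} : Finset V).card = 5 := by
    simp [hca.ne, hcb.ne, hck.ne, hcl.ne, hab.ne, hak.ne, hnal, hnbk, hbl.ne, hne]
  refine bound_of_slack (D := {c, a, b, k, l}) (m := 3) hC (by simp [Finset.insert_subset_iff, *])
    (by simp) hK ((bound_gem hca hcb hck hcl hab hak hbl hnal hnbk hne).mono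
      (by rw [hcard]; norm_num)) ?_
  set R := C \ {c, a, b, k, l} with hR
  have hxR : x ∈ R := by simp [hR, hx, hxc, hax.ne', hbx.ne', hxk, hxl]
  have d1 : Dom G R 1 (fun r => G.Adj r k ∧ ¬ G.Adj r a) := by
    refine dom_clique ?_
    rintro r hr s hs ⟨hrk, hra⟩ ⟨hsk, hsa⟩ hrs
    simp only [hR, Finset.mem_sdiff, Finset.mem_insert, Finset.mem_singleton, not_or] at hr hs
    rcases hG k r s a hrk.symm hsk.symm hak.symm hrs hs.2.2.1 hr.2.2.1 with h | h | h
    · exact h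
    · exact absurd h hsa
    · exact absurd h hra
  have d2 : Dom G R 1 (fun r => G.Adj r l ∧ ¬ G.Adj r b) := by
    refine dom_clique ?_
    rintro r hr s hs ⟨hrk, hra⟩ ⟨hsk, hsa⟩ hrs
    simp only [hR, Finset.mem_sdiff, Finset.mem_insert, Finset.mem_singleton, not_or] at hr hs
    rcases hG l r s b hrk.symm hsk.symm hbl.symm hrs hs.2.2.2.1 hr.2.2.2.1 with h | h | h
    · exact h
    · exact absurd h hsa
    · exact absurd h hra
  refine (((dom_singleton hxR).or d1).or d2).mono fun r hr h => ?_
  simp only [hR, Finset.mem_sdiff, Finset.mem_insert, Finset.mem_singleton, not_or] at hr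
  obtain ⟨hrC, hrc, hra, hrb, hrk, hrl⟩ := hr
  simp only [Finset.mem_insert, Finset.mem_singleton, exists_eq_or_imp, exists_eq_left] at h
  by_cases hrx : r = x
  · exact Or.inl (Or.inl (Or.inl hrx))
  have hA : G.Adj r a → G.Adj r x := by
    intro h
    have hrc' : ¬ G.Adj c r := by
      intro hcr
      rcases hG a b k r hab hak h.symm hnbk (Ne.symm hrk) (Ne.symm hrb) with e | e | e
      · exact hbk e
      · exact hno a ha c hc k hk r hrC hca.symm hak h.symm hck hcr e
      · exact hno a ha b hb c hc r hrC hab hca.symm h.symm hcb.symm e hcr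
    rcases hG a c x r hca.symm hax h.symm hxc.symm (Ne.symm hrx) (Ne.symm hrc) with e | e | e
    · exact absurd e hcx
    · exact e.symm
    · exact absurd e hrc'
  have hB : G.Adj r b → G.Adj r x := by
    intro h
    have hrc' : ¬ G.Adj c r := by
      intro hcr
      rcases hG b a l r hab.symm hbl h.symm hnal (Ne.symm hrl) (Ne.symm hra) with e | e | e
      · exact hal e
      · exact hno b hb c hc l hl r hrC hcb.symm hbl h.symm hcl hcr e
      · exact hno a ha b hb c hc r hrC hab hca.symm e hcb.symm h.symm hcr
    rcases hG b c x r hcb.symm hbx h.symm hxc.symm (Ne.symm hrx) (Ne.symm hrc) with e | e | e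
    · exact absurd e hcx
    · exact e.symm
    · exact absurd e hrc'
  have hC' : G.Adj r c → ¬ G.Adj r b → G.Adj r k := by
    intro h hn
    rcases hG c r k b h.symm hck hcb hrk hnbk.symm hrb with e | e | e
    · exact e
    · exact absurd e.symm hbk
    · exact absurd e hn
  by_cases hxr : G.Adj r x
  · exact Or.inl (Or.inl (Or.inr hxr))
  have ha' : ¬ G.Adj r a := fun h => hxr (hA h)
  have hb' : ¬ G.Adj r b := fun h => hxr (hB h)
  rcases h with h | h | h | h | h
  · exact Or.inl (Or.inr ⟨hC' h hb', ha'⟩)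
  · exact absurd h ha'
  · exact absurd h hb'
  · exact Or.inl (Or.inr ⟨h, ha'⟩)
  · exact Or.inr ⟨h, hb'⟩

theorem NoClaw.bound_of_diamond (hG : NoClaw G) {C : Finset V} (hC : Conn G C)
    (hK : ∀ K ⊂ C, Conn G K → Bound G K (K.card - 1))
    (hno : ∀ a ∈ C, ∀ b ∈ C, ∀ c ∈ C, ∀ d ∈ C, G.Adj a b → G.Adj a c → G.Adj a d → G.Adj b c →
      G.Adj b d → ¬ G.Adj c d) {a b c x : V} (ha : a ∈ C) (hb : b ∈ C) (hc : c ∈ C) (hx : x ∈ C)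
    (hab : G.Adj a b) (hca : G.Adj c a) (hcb : G.Adj c b) (hax : G.Adj a x) (hbx : G.Adj b x)
    (hxc : x ≠ c) : Bound G C C.card := by
  have hcx : ¬ G.Adj c x := hno a ha b hb c hc x hx hab hca.symm hax hcb.symm hbx
  have hcard : ({a, b, c, x} : Finset V).card = 4 := by
    simp [hab.ne, hca.ne', hax.ne, hcb.ne', hbx.ne, hxc.symm]
  have key : ∀ c x, c ∈ C → x ∈ C → G.Adj c a → G.Adj c b → G.Adj a x → G.Adj b x → x ≠ c →
      ¬ G.Adj c x → ∀ k ∈ C \ {a, b, c, x}, ∀ l ∈ C \ {a, b, c, x},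
      G.Adj c k → G.Adj c l → k ≠ l → ¬ G.Adj k l → Bound G C C.card := by
    intro c x hc hx hca hcb hax hbx hxc hcx k hk l hl hck hcl hne hkl
    simp only [Finset.mem_sdiff, Finset.mem_insert, Finset.mem_singleton, not_or] at hk hl
    have h1 : G.Adj a k ∨ G.Adj a l := by
      rcases hG c k l a hck hcl hca hne hl.2.1 hk.2.1 with e | e | e
      · exact absurd e hkl
      · exact Or.inr e.symm
      · exact Or.inl e.symm
    have h2 : G.Adj b k ∨ G.Adj b l := by
      rcases hG c k l b hck hcl hcb hne hl.2.2.1 hk.2.2.1 with e | e | e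
      · exact absurd e hkl
      · exact Or.inr e.symm
      · exact Or.inl e.symm
    rcases h1 with h1 | h1 <;> rcases h2 with h2 | h2
    · exact absurd hck (hno a ha b hb c hc k hk.1 hab hca.symm h1 hcb.symm h2)
    · exact hG.bound_of_gem hC hK hno ha hb hc hx hk.1 hl.1 hab hca hcb hax hbx hcx hck hcl hkl hne
        h1 h2 hxc
    · exact hG.bound_of_gem hC hK hno ha hb hc hx hl.1 hk.1 hab hca hcb hax hbx hcx hcl hck
        (fun h => hkl h.symm) hne.symm h1 h2 hxc
    · exact absurd hcl (hno a ha b hb c hc l hl.1 hab hca.symm h1 hcb.symm h2)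
  by_cases h1 : ∃ k ∈ C \ {a, b, c, x}, ∃ l ∈ C \ {a, b, c, x},
      G.Adj c k ∧ G.Adj c l ∧ k ≠ l ∧ ¬ G.Adj k l
  · obtain ⟨k, hk, l, hl, hck, hcl, hne, hkl⟩ := h1
    exact key c x hc hx hca hcb hax hbx hxc hcx k hk l hl hck hcl hne hkl
  by_cases h2 : ∃ k ∈ C \ {a, b, c, x}, ∃ l ∈ C \ {a, b, c, x},
      G.Adj x k ∧ G.Adj x l ∧ k ≠ l ∧ ¬ G.Adj k l
  · obtain ⟨k, hk, l, hl, hck, hcl, hne, hkl⟩ := h2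
    rw [Finset.pair_comm c x] at hk hl
    exact key x c hx hc hax.symm hbx.symm hca.symm hcb.symm hxc.symm (fun h => hcx h.symm)
      k hk l hl hck hcl hne hkl
  refine bound_of_slack (D := {a, b, c, x}) (m := 2) hC (by simp [Finset.insert_subset_iff, *])
    (by simp) hK ((bound_diamond hab hca.symm hcb.symm hax hbx hxc.symm).mono
      (by rw [hcard]; norm_num)) ?_
  push Not at h1 h2
  have d1 : Dom G (C \ {a, b, c, x}) 1 (fun r => G.Adj r c) :=
    dom_clique fun r hr s hs hrc hsc hrs => h1 r hr s hs hrc.symm hsc.symm hrs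
  have d2 : Dom G (C \ {a, b, c, x}) 1 (fun r => G.Adj r x) :=
    dom_clique fun r hr s hs hrc hsc hrs => h2 r hr s hs hrc.symm hsc.symm hrs
  refine (d1.or d2).mono fun r hr h => ?_
  simp only [Finset.mem_sdiff, Finset.mem_insert, Finset.mem_singleton, not_or] at hr
  simp only [Finset.mem_insert, Finset.mem_singleton, exists_eq_or_imp, exists_eq_left] at h
  have key2 : ∀ v, G.Adj v c → G.Adj v x → G.Adj r v → G.Adj r c ∨ G.Adj r x := by
    intro v hvc hvx hrv
    rcases hG v c x r hvc hvx hrv.symm hxc.symm (Ne.symm hr.2.2.2.2) (Ne.symm hr.2.2.2.1) with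
      e | e | e
    · exact absurd e hcx
    · exact Or.inr e.symm
    · exact Or.inl e.symm
  rcases h with h | h | h
  · exact key2 a hca.symm hax h
  · exact key2 b hcb.symm hbx h
  · exact h

end Dense

section Sparse

variable {V : Type*} [Fintype V] [DecidableEq V] {G : SimpleGraph V} [DecidableRel G.Adj]

theorem edges2_triangle {a b c : V} (hab : G.Adj a b) (hac : G.Adj a c) (hbc : G.Adj b c) :
    edges2 G {a, b, c} = 6 := by
  rw [edges2_insert G (by simp [hab.ne, hac.ne]), edges2_insert G (by simp [hbc.ne]),
    edges2_singleton]
  simp [degIn, Finset.filter_insert, Finset.filter_singleton, hab, hac, hbc, hbc.ne]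

theorem earQuad_triangle {a b c : V} (hab : G.Adj a b) (hac : G.Adj a c) (hbc : G.Adj b c) :
    EarQuad G {a, b, c} a := by
  have := (earQuad_singleton G a).insert G (b := b) (c := c) (by simp [hab.ne'])
    (by simp [hac.ne']) (by simp) hbc (by simp [hab.symm]) (by simp [hac.symm])
  convert this using 1
  ext z
  simp
  tauto

/-- Two triangles sharing the vertex `a`, with no further edges. -/
structure Bowtie (G : SimpleGraph V) (a b c d e : V) : Prop where
  ab : G.Adj a b
  ac : G.Adj a c
  ad : G.Adj a d
  ae : G.Adj a e
  bc : G.Adj b c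
  de : G.Adj d e
  bd : ¬ G.Adj b d
  be : ¬ G.Adj b e
  cd : ¬ G.Adj c d
  ce : ¬ G.Adj c e
  nbd : b ≠ d
  nbe : b ≠ e
  ncd : c ≠ d
  nce : c ≠ e

namespace Bowtie

variable {a b c d e : V}

theorem card (h : Bowtie G a b c d e) : ({a, b, c, d, e} : Finset V).card = 5 := by
  simp [h.ab.ne, h.ac.ne, h.ad.ne, h.ae.ne, h.bc.ne, h.de.ne, h.nbd, h.nbe, h.ncd, h.nce]

theorem edges2_eq (h : Bowtie G a b c d e) : edges2 G {a, b, c, d, e} = 12 := by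
  rw [edges2_insert G (by simp [h.ab.ne, h.ac.ne, h.ad.ne, h.ae.ne]),
    edges2_insert G (by simp [h.bc.ne, h.nbd, h.nbe]),
    edges2_insert G (by simp [h.ncd, h.nce]), edges2_insert G (by simp [h.de.ne]),
    edges2_singleton]
  simp [degIn, Finset.filter_insert, Finset.filter_singleton, h.ab, h.ac, h.ad, h.ae, h.bc, h.de,
    h.bd, h.be, h.cd, h.ce, h.bc.ne, h.de.ne, h.nbd, h.nbe, h.ncd, h.nce]

theorem quad (h : Bowtie G a b c d e) : Quad G {a, b, c, d, e} := by
  have := ((earQuad_triangle h.ab h.ac h.bc).insert G (b := d) (c := e)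
    (by simp [h.ad.ne', h.nbd.symm, h.ncd.symm]) (by simp [h.ae.ne', h.nbe.symm, h.nce.symm])
    (by simp) h.de (by simp [h.ad, h.ab.ne', h.ac.ne', G.adj_comm d, h.bd, h.cd])
    (by simp [h.ae, h.ab.ne', h.ac.ne', G.adj_comm e, h.be, h.ce])).quad G
  convert this using 1
  ext z
  simp
  tauto

theorem swap (h : Bowtie G a b c d e) : Bowtie G a d e b c :=
  ⟨h.ad, h.ae, h.ab, h.ac, h.de, h.bc, fun h' => h.bd h'.symm, fun h' => h.cd h'.symm,
    fun h' => h.be h'.symm, fun h' => h.ce h'.symm, h.nbd.symm, h.ncd.symm, h.nbe.symm, h.nce.symm⟩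

theorem flip (h : Bowtie G a b c d e) : Bowtie G a c b d e :=
  ⟨h.ac, h.ab, h.ad, h.ae, h.bc.symm, h.de, h.cd, h.ce, h.bd, h.be, h.ncd, h.nce, h.nbd, h.nbe⟩

end Bowtie

/-- Every edge of `C` is in at most one triangle of `C`. -/
def NoDiamond (G : SimpleGraph V) (C : Finset V) : Prop :=
  ∀ p ∈ C, ∀ q ∈ C, ∀ x ∈ C, ∀ y ∈ C, G.Adj p q → G.Adj p x → G.Adj q x → G.Adj p y →
    G.Adj q y → x = y

/-- Any two triangles of `C` meet. -/
def NoDisjTri (G : SimpleGraph V) (C : Finset V) : Prop :=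
  ∀ x ∈ C, ∀ y ∈ C, ∀ z ∈ C, ∀ u ∈ C, ∀ v ∈ C, ∀ w ∈ C, G.Adj x y → G.Adj x z → G.Adj y z →
    G.Adj u v → G.Adj u w → G.Adj v w → ¬ Disjoint ({x, y, z} : Finset V) {u, v, w}

theorem Bowtie.not_adj_center (hG : NoClaw G) {C : Finset V} (hnd : NoDiamond G C)
    {a b c d e : V} (h : Bowtie G a b c d e) (hB : ({a, b, c, d, e} : Finset V) ⊆ C) :
    ∀ r ∈ C \ {a, b, c, d, e}, ¬ G.Adj a r := by
  intro r hr har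
  simp only [Finset.mem_sdiff, Finset.mem_insert, Finset.mem_singleton, not_or] at hr
  simp only [Finset.insert_subset_iff, Finset.singleton_subset_iff] at hB
  rcases hG a b d r h.ab h.ad har h.nbd (Ne.symm hr.2.2.2.2.1) (Ne.symm hr.2.2.1) with h' | h' | h'
  · exact h.bd h'
  · exact hr.2.2.2.2.2 (hnd a hB.1 d hB.2.2.2.1 r hr.1 e hB.2.2.2.2 h.ad har h' h.ae h.de)
  · exact hr.2.2.2.1 (hnd a hB.1 b hB.2.1 r hr.1 c hB.2.2.1 h.ab har h' h.ac h.bc)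

theorem Bowtie.outer_unique (hG : NoClaw G) {C : Finset V} (hnd : NoDiamond G C)
    (hdt : NoDisjTri G C) {a b c d e : V} (h : Bowtie G a b c d e)
    (hB : ({a, b, c, d, e} : Finset V) ⊆ C) :
    ∀ r ∈ C \ {a, b, c, d, e}, ∀ s ∈ C \ {a, b, c, d, e}, G.Adj b r → G.Adj b s → r = s := by
  intro r hr s hs hbr hbs
  have har := h.not_adj_center hG hnd hB r hr
  have has := h.not_adj_center hG hnd hB s hs
  simp only [Finset.mem_sdiff, Finset.mem_insert, Finset.mem_singleton, not_or] at hr hs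
  simp only [Finset.insert_subset_iff, Finset.singleton_subset_iff] at hB
  by_contra hrs
  rcases hG b a r s h.ab.symm hbr hbs (Ne.symm hr.2.1) hrs (Ne.symm hs.2.1) with h' | h' | h'
  · exact har h'
  · refine hdt b hB.2.1 r hr.1 s hs.1 a hB.1 d hB.2.2.2.1 e hB.2.2.2.2 hbr hbs h' h.ad h.ae h.de ?_
    have := h.ab.ne
    have := h.nbd
    have := h.nbe
    rw [Finset.disjoint_left]
    simp only [Finset.mem_insert, Finset.mem_singleton]
    grind
  · exact has h'

theorem Bowtie.degIn_outer (hG : NoClaw G) {C : Finset V} (hnd : NoDiamond G C)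
    (hdt : NoDisjTri G C) {a b c d e : V} (h : Bowtie G a b c d e)
    (hB : ({a, b, c, d, e} : Finset V) ⊆ C) :
    ∀ u ∈ C \ {a, b, c, d, e}, degIn G C u ≤ 2 := by
  intro u hu
  have hau := h.not_adj_center hG hnd hB u hu
  simp only [Finset.mem_sdiff, Finset.mem_insert, Finset.mem_singleton, not_or] at hu
  simp only [Finset.insert_subset_iff, Finset.singleton_subset_iff] at hB
  refine hG.degIn_le_two fun x hx y hy hux huy hxy => ?_
  have h1 := hdt u hu.1 x hx y hy a hB.1 b hB.2.1 c hB.2.2.1 hux huy hxy h.ab h.ac h.bc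
  have h2 := hdt u hu.1 x hx y hy a hB.1 d hB.2.2.2.1 e hB.2.2.2.2 hux huy hxy h.ad h.ae h.de
  obtain ⟨p, hp, hp'⟩ := Finset.not_disjoint_iff.1 h1
  obtain ⟨q, hq, hq'⟩ := Finset.not_disjoint_iff.1 h2
  have hpq : ¬ G.Adj p q ∧ p ≠ q := by
    have e1 : p = b ∨ p = c := by
      simp only [Finset.mem_insert, Finset.mem_singleton] at hp hp'
      have := G.adj_comm a u
      grind
    have e2 : q = d ∨ q = e := by
      simp only [Finset.mem_insert, Finset.mem_singleton] at hq hq'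
      have := G.adj_comm a u
      grind
    rcases e1 with rfl | rfl <;> rcases e2 with rfl | rfl
    exacts [⟨h.bd, h.nbd⟩, ⟨h.be, h.nbe⟩, ⟨h.cd, h.ncd⟩, ⟨h.ce, h.nce⟩]
  simp only [Finset.mem_insert, Finset.mem_singleton] at hp hq
  have := G.adj_comm x u
  have := G.adj_comm y u
  have := G.adj_comm x y
  grind

/-- Degrees into a saturated set attached to a bowtie. -/
theorem Bowtie.sum_degIn (hG : NoClaw G) {C X : Finset V} (hnd : NoDiamond G C)
    {a b c d e : V} (h : Bowtie G a b c d e) (hX : Sat G C {a, b, c, d, e} X) :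
    ∑ z ∈ ({a, b, c, d, e} : Finset V), degIn G X z =
      degIn G X b + degIn G X c + degIn G X d + degIn G X e := by
  have hXs : X ⊆ C \ {a, b, c, d, e} := fun x hx =>
    Finset.mem_sdiff.2 ⟨hX.subset hx, Finset.disjoint_right.1 hX.disj hx⟩
  rw [Finset.sum_insert (by simp [h.ab.ne, h.ac.ne, h.ad.ne, h.ae.ne]),
    Finset.sum_insert (by simp [h.bc.ne, h.nbd, h.nbe]),
    Finset.sum_insert (by simp [h.ncd, h.nce]), Finset.sum_insert (by simp [h.de.ne]),
    Finset.sum_singleton,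
    degIn_eq_zero G fun x hx => h.not_adj_center hG hnd hX.base x (hXs hx)]
  omega

theorem Bowtie.outer_degIn_le_one (hG : NoClaw G) {C X : Finset V} (hnd : NoDiamond G C)
    (hdt : NoDisjTri G C) {a b c d e : V} (h : Bowtie G a b c d e)
    (hX : Sat G C {a, b, c, d, e} X) : ∀ z ∈ ({b, c, d, e} : Finset V),
    (∀ r ∈ C \ {a, b, c, d, e}, ∀ s ∈ C \ {a, b, c, d, e}, G.Adj z r → G.Adj z s → r = s) ∧
    degIn G X z ≤ 1 := by
  intro z hz
  have hXs : X ⊆ C \ {a, b, c, d, e} := fun x hx =>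
    Finset.mem_sdiff.2 ⟨hX.subset hx, Finset.disjoint_right.1 hX.disj hx⟩
  have key : ∀ r ∈ C \ {a, b, c, d, e}, ∀ s ∈ C \ {a, b, c, d, e}, G.Adj z r → G.Adj z s →
      r = s := by
    have e1 : ({a, c, b, d, e} : Finset V) = {a, b, c, d, e} := by
      rw [Finset.insert_comm c b]
    have e2 : ({a, d, e, b, c} : Finset V) = {a, b, c, d, e} := by
      ext; simp; tauto
    have e3 : ({a, e, d, b, c} : Finset V) = {a, b, c, d, e} := by
      ext; simp; tauto
    simp only [Finset.mem_insert, Finset.mem_singleton] at hz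
    rcases hz with rfl | rfl | rfl | rfl
    · exact h.outer_unique hG hnd hdt hX.base
    · have := h.flip.outer_unique hG hnd hdt (e1 ▸ hX.base)
      rwa [e1] at this
    · have := h.swap.outer_unique hG hnd hdt (e2 ▸ hX.base)
      rwa [e2] at this
    · have := h.swap.flip.outer_unique hG hnd hdt (e3 ▸ hX.base)
      rwa [e3] at this
  exact ⟨key, degIn_le_one G fun x hx y hy => key x (hXs hx) y (hXs hy)⟩

theorem Bowtie.bound_of_four (hG : NoClaw G) {C X : Finset V} (hC : Conn G C)
    (hK : ∀ K ⊂ C, Conn G K → Bound G K (K.card - 1)) (hnd : NoDiamond G C)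
    (hdt : NoDisjTri G C) {a b c d e : V} (h : Bowtie G a b c d e)
    (hX : Sat G C {a, b, c, d, e} X)
    (h4 : ∑ z ∈ ({a, b, c, d, e} : Finset V), degIn G X z = 4) : Bound G C C.card := by
  set B : Finset V := {a, b, c, d, e} with hB
  have hXs : X ⊆ C \ B := fun x hx =>
    Finset.mem_sdiff.2 ⟨hX.subset hx, Finset.disjoint_right.1 hX.disj hx⟩
  have hle := h.outer_degIn_le_one hG hnd hdt hX
  have hXC : X = C \ B := by
    by_contra hne
    have hU : B ∪ X ⊆ C := hX.union_subset
    obtain ⟨u, hu, w, hw, huw⟩ := hC.2 (B ∪ X) hU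
      (hX.nonempty.mono Finset.subset_union_right) (by
        rw [Finset.sdiff_nonempty]
        intro hs
        refine hne (hXs.antisymm fun z hz => ?_)
        rw [Finset.mem_sdiff] at hz
        exact (Finset.mem_union.1 (hs hz.1)).resolve_left hz.2)
    rw [Finset.mem_sdiff, Finset.mem_union, not_or] at hw
    have hwC : w ∈ C \ B := Finset.mem_sdiff.2 ⟨hw.1, hw.2.1⟩
    rcases Finset.mem_union.1 hu with hu | hu
    · have hua : u ≠ a := by
        rintro rfl
        exact h.not_adj_center hG hnd hX.base w hwC huw
      have hu' : u ∈ ({b, c, d, e} : Finset V) :=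
        (Finset.mem_insert.1 hu).resolve_left hua
      have hpos : 0 < degIn G X u := by
        rw [h.sum_degIn hG hnd hX] at h4
        have h1 := (hle b (by simp)).2
        have h2 := (hle c (by simp)).2
        have h3 := (hle d (by simp)).2
        have h5 := (hle e (by simp)).2
        simp only [Finset.mem_insert, Finset.mem_singleton] at hu'
        rcases hu' with rfl | rfl | rfl | rfl <;> omega
      obtain ⟨x, hx, hux⟩ := exists_of_degIn_pos G hpos
      have := (hle u hu').1 x (hXs hx) w hwC hux huw
      exact hw.2.2 (this ▸ hx)
    · exact (Finset.mem_union.1 (hX.closed u hu w hw.1 huw)).elim hw.2.1 hw.2.2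
  have hsum : ∑ u ∈ C \ B, (degIn G B u : ℝ) / 2 = 2 := by
    rw [← hXC, ← Finset.sum_div, ← Nat.cast_sum, sum_degIn_comm, h4]
    norm_num
  have hR := bound_of_conn (G := G) (R := C \ B) (fun u => (degIn G B u : ℝ) / 2)
    (fun K hK' => hK K (lt_of_le_of_lt hK' (Finset.sdiff_ssubset hX.base ⟨a, by simp [hB]⟩)))
    (fun U hU hUn hUc => by
      have hUX : U ⊆ X := hXC ▸ hU
      have hUs : Sat G C B U :=
        { subset := hU.trans Finset.sdiff_subset
          base := hX.base
          disj := hX.disj.mono_right hUX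
          nonempty := hUn
          deg := fun u hu => by
            rw [← hX.degIn_eq (hUX hu)]
            unfold degIn
            congr 1
            ext w
            simp only [Finset.mem_filter, and_congr_left_iff, Finset.mem_union]
            intro huw
            constructor
            · rintro (hw | hw)
              · exact hX.base hw
              · exact hX.subset (hUX hw)
            · intro hw
              by_contra hn
              push Not at hn
              exact hUc u hu w (by simp [hw, hn]) huw
          closed := fun u hu w hw huw => by
            by_contra hn
            rw [Finset.mem_union, not_or] at hn
            exact hUc u hu w (by simp [hw, hn]) huw }
      have := hUs.two_le hC ⟨a, by simp [hB]⟩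
      rw [← Finset.sum_div, ← Nat.cast_sum, ← sum_degIn_comm]
      have : ((2 : ℕ) : ℝ) ≤ ((∑ z ∈ B, degIn G U z : ℕ) : ℝ) := by exact_mod_cast this
      push_cast at this ⊢
      linarith)
  rw [hsum] at hR
  have hb := bound_bowtie h.ab h.ac h.ad h.ae h.bc h.de h.nbd h.nbe h.ncd h.nce
  have := hb.union hR Finset.disjoint_sdiff
  rw [← hB, Finset.union_sdiff_of_subset hX.base] at this
  refine this.mono (le_of_eq ?_)
  rw [Finset.card_sdiff_of_subset hX.base, Nat.cast_sub (Finset.card_le_card hX.base), h.card]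
  push_cast
  ring

theorem Bowtie.bound (hG : NoClaw G) {C : Finset V} (hC : Conn G C)
    (hK : ∀ K ⊂ C, Conn G K → Bound G K (K.card - 1)) (hnd : NoDiamond G C)
    (hdt : NoDisjTri G C) {a b c d e : V} (h : Bowtie G a b c d e)
    (hBC : ({a, b, c, d, e} : Finset V) ⊆ C) : Bound G C C.card := by
  set B : Finset V := {a, b, c, d, e} with hB
  have hBn : B.Nonempty := ⟨a, by simp [hB]⟩
  have hdeg := h.degIn_outer hG hnd hdt hBC
  have hcard : B.card = 5 := h.card
  have hedge : edges2 G B = 12 := h.edges2_eq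
  by_cases hp : PeelTo G B C
  · have hg := hC.edges2_growth hBC hBn
    exact (Quad.of_peelTo G h.quad hp).bound_edges G (by omega)
  obtain ⟨X, -, hX⟩ := exists_sat subset_rfl hBC hdeg hp
  obtain ⟨y, hy, z, hz, hyz⟩ := hX.exists_adj hC hBn
  have hyB : y ∉ B := Finset.disjoint_right.1 hX.disj hy
  have hyC := hX.subset hy
  by_cases hp' : PeelTo G B (C.erase y)
  · have h1 := hX.edges2_eq
    have h2 := hX.two_le hC hBn
    have h3 := hC.edges2_growth hX.union_subset (hBn.mono Finset.subset_union_left)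
    rw [Finset.card_union_of_disjoint hX.disj] at h3
    have h4 := edges2_insert G (Finset.notMem_erase y C)
    rw [Finset.insert_erase hyC, degIn_erase_of_not_adj G (G.loopless.irrefl y),
      hX.degIn_eq hy] at h4
    have hq : Bound G (C.erase y) C.card :=
      (Quad.of_peelTo G h.quad hp').bound_edges G (by omega)
    have := hq.union (bound_zero {y}) (Finset.disjoint_singleton_right.2 (Finset.notMem_erase y C))
    rw [Finset.union_comm, ← Finset.insert_eq, Finset.insert_erase hyC] at this
    exact this.mono (by linarith)
  obtain ⟨Y, hYC, hY⟩ := exists_sat (Finset.erase_subset y C)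
    (fun z hz => Finset.mem_erase.2 ⟨fun e => hyB (e ▸ hz), hBC hz⟩) hdeg hp'
  have hyY : y ∉ Y := fun hyY => Finset.notMem_erase y C (hYC hyY)
  have hZ := hX.union hY
  refine h.bound_of_four hG hC hK hnd hdt hZ ?_
  have h1 := hY.two_le hC hBn
  have h2 : ∑ z ∈ B, degIn G Y z < ∑ z ∈ B, degIn G (X ∪ Y) z := by
    refine Finset.sum_lt_sum (fun z _ => degIn_mono G Finset.subset_union_right z) ⟨z, hz, ?_⟩
    refine Finset.card_lt_card (Finset.ssubset_iff_of_subset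
      (Finset.filter_subset_filter _ Finset.subset_union_right) |>.2 ⟨y, ?_, ?_⟩)
    · simp [hy, hyz.symm]
    · simp [hyY]
  have hev : Even (∑ z ∈ B, degIn G (X ∪ Y) z) := hZ.even
  obtain ⟨k, hk⟩ := hev
  have hle := h.outer_degIn_le_one hG hnd hdt hZ
  have h3 : ∑ z ∈ B, degIn G (X ∪ Y) z = _ := h.sum_degIn hG hnd hZ
  have h4 := (hle b (by simp)).2
  have h5 := (hle c (by simp)).2
  have h6 := (hle d (by simp)).2
  have h7 := (hle e (by simp)).2
  change ∑ z ∈ B, degIn G (X ∪ Y) z = 4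
  omega

end Sparse

section Main

variable {V : Type*} [Fintype V] [DecidableEq V] {G : SimpleGraph V} [DecidableRel G.Adj]

theorem NoClaw.unique_of_triangle (hG : NoClaw G) {C T : Finset V}
    (htri : ∀ u ∈ C \ T, ∀ x ∈ C, ∀ y ∈ C, G.Adj u x → G.Adj u y → ¬ G.Adj x y)
    {a b : V} (ha : a ∈ C) (hb : b ∈ C) (hbT : b ∈ T) (hab : G.Adj a b) :
    ∀ r ∈ C \ T, ∀ s ∈ C \ T, G.Adj a r → G.Adj a s → r = s := by
  intro r hr s hs har has
  by_contra hrs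
  have hrC := (Finset.mem_sdiff.1 hr).1
  have hsC := (Finset.mem_sdiff.1 hs).1
  have hrb : r ≠ b := fun h => (Finset.mem_sdiff.1 hr).2 (h ▸ hbT)
  have hsb : s ≠ b := fun h => (Finset.mem_sdiff.1 hs).2 (h ▸ hbT)
  rcases hG a r s b har has hab hrs hsb hrb with h | h | h
  · exact htri r hr a ha s hsC har.symm h has
  · exact htri s hs a ha b hb has.symm h hab
  · exact htri r hr a ha b hb har.symm h hab

/-- The case of a single triangle to which a saturated set is attached at `a` and `b`. -/
theorem NoClaw.bound_of_two (hG : NoClaw G) {C : Finset V} (hC : Conn G C)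
    (hK : ∀ K ⊂ C, Conn G K → Bound G K (K.card - 1)) {a b c : V} {X : Finset V}
    (hab : G.Adj a b) (hac : G.Adj a c) (hbc : G.Adj b c)
    (htri : ∀ u ∈ C \ {a, b, c}, ∀ x ∈ C, ∀ y ∈ C, G.Adj u x → G.Adj u y → ¬ G.Adj x y)
    (hX : Sat G C {a, b, c} X) (ha : 0 < degIn G X a) (hb : 0 < degIn G X b)
    (hc : degIn G X c = 0) : Bound G C C.card := by
  have hXs : X ⊆ C \ {a, b, c} := fun x hx =>
    Finset.mem_sdiff.2 ⟨hX.subset hx, Finset.disjoint_right.1 hX.disj hx⟩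
  have hTC := hX.base
  have haC : a ∈ C := hTC (by simp)
  have hbC : b ∈ C := hTC (by simp)
  have hcC : c ∈ C := hTC (by simp)
  have ua := hG.unique_of_triangle htri haC hbC (by simp) hab
  have ub := hG.unique_of_triangle htri hbC haC (by simp) hab.symm
  have uc := hG.unique_of_triangle htri hcC haC (by simp) hac.symm
  obtain ⟨y, hy, hay⟩ := exists_of_degIn_pos G ha
  obtain ⟨z, hz, hbz⟩ := exists_of_degIn_pos G hb
  set U : Finset V := {a, b, c} ∪ X with hU
  have hTU : ({a, b, c} : Finset V) ⊆ U := Finset.subset_union_left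
  have hUX : ∀ u ∈ U, u ∉ ({a, b, c} : Finset V) → u ∈ X := fun u hu hn =>
    (Finset.mem_union.1 hu).resolve_left hn
  have hnX : ∀ x ∈ X, x ∉ ({a, b, c} : Finset V) := fun x hx => Finset.disjoint_right.1 hX.disj hx
  have hbound : Bound G U (U.card + 1) := by
    refine bound_house G hab hac hbc hTU (Finset.mem_union_right _ hy) (hnX y hy) hay
      (fun u hu hn hau => ua u (hXs (hUX u hu hn)) y (hXs hy) hau hay)
      (fun u hu hn v hv hn' hbu hbv => ub u (hXs (hUX u hu hn)) v (hXs (hUX v hv hn')) hbu hbv)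
      (fun u hu hn hcu => ?_) (fun u hu hn => hX.deg u (hUX u hu hn)) ?_ fun Y hY hYn => ?_
    · have := degIn_pos G (hUX u hu hn) hcu
      omega
    · rw [hU, degIn_union G hX.disj]
      have : 2 ≤ degIn G {a, b, c} b := by
        simp [degIn, Finset.filter_insert, Finset.filter_singleton, hab.symm, hbc, hac.ne]
      omega
    · have hYX : Y ⊆ X := fun v hv => hUX v (Finset.mem_sdiff.1 (hY hv)).1
        (Finset.mem_sdiff.1 (hY hv)).2
      obtain ⟨u, hu, w, hw, huw⟩ := hC.2 Y (hYX.trans hX.subset) hYn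
        ⟨a, Finset.mem_sdiff.2 ⟨haC, fun h => hnX a (hYX h) (by simp)⟩⟩
      rw [Finset.mem_sdiff] at hw
      exact ⟨u, hu, w, Finset.mem_sdiff.2 ⟨hX.closed u (hYX hu) w hw.1 huw, hw.2⟩, huw⟩
  refine bound_of_slack (m := 1) hC hX.union_subset ⟨a, hTU (by simp)⟩ hK
    (by rwa [Nat.cast_one]) ?_
  have key : ∀ r ∈ C \ U, (∃ d ∈ U, G.Adj r d) → G.Adj r c := by
    rintro r hr ⟨d, hd, hrd⟩
    simp only [hU, Finset.mem_sdiff, Finset.mem_union, not_or] at hr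
    have hrT : r ∈ C \ {a, b, c} := Finset.mem_sdiff.2 ⟨hr.1, hr.2.1⟩
    rcases Finset.mem_union.1 hd with hd | hd
    · simp only [Finset.mem_insert, Finset.mem_singleton] at hd
      rcases hd with rfl | rfl | rfl
      · exact absurd (ua r hrT y (hXs hy) hrd.symm hay ▸ hy) hr.2.2
      · exact absurd (ub r hrT z (hXs hz) hrd.symm hbz ▸ hz) hr.2.2
      · exact hrd
    · exact absurd (hX.closed d hd r hr.1 hrd.symm) (by simp only [Finset.mem_union]; tauto)
  refine (dom_clique (p := fun r => G.Adj r c) fun r hr s hs hrc hsc hrs => ?_).mono key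
  have hsub : C \ U ⊆ C \ {a, b, c} := Finset.sdiff_subset_sdiff subset_rfl hTU
  exact absurd (uc r (hsub hr) s (hsub hs) hrc.symm hsc.symm) hrs

theorem NoClaw.bound_of_unique_triangle (hG : NoClaw G) {C : Finset V} (hC : Conn G C)
    (hK : ∀ K ⊂ C, Conn G K → Bound G K (K.card - 1)) {a b c : V}
    (haC : a ∈ C) (hbC : b ∈ C) (hcC : c ∈ C)
    (hab : G.Adj a b) (hac : G.Adj a c) (hbc : G.Adj b c)
    (htri : ∀ u ∈ C \ {a, b, c}, ∀ x ∈ C, ∀ y ∈ C, G.Adj u x → G.Adj u y → ¬ G.Adj x y) :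
    Bound G C C.card := by
  have hTC : ({a, b, c} : Finset V) ⊆ C := by simp [Finset.insert_subset_iff, *]
  have hTn : ({a, b, c} : Finset V).Nonempty := ⟨a, by simp⟩
  have hcard : ({a, b, c} : Finset V).card = 3 := by simp [hab.ne, hac.ne, hbc.ne]
  by_cases hp : PeelTo G {a, b, c} C
  · have hg := hC.edges2_growth hTC hTn
    rw [edges2_triangle hab hac hbc, hcard] at hg
    exact (Quad.of_peelTo G (earQuad_triangle hab hac hbc).quad hp).bound_edges G (by omega)
  have hdeg : ∀ u ∈ C \ {a, b, c}, degIn G C u ≤ 2 := fun u hu =>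
    hG.degIn_le_two fun x hx y hy hux huy => htri u hu x hx y hy hux huy
  obtain ⟨X, -, hX⟩ := exists_sat subset_rfl hTC hdeg hp
  have hXs : X ⊆ C \ {a, b, c} := fun x hx =>
    Finset.mem_sdiff.2 ⟨hX.subset hx, Finset.disjoint_right.1 hX.disj hx⟩
  have ha1 := degIn_le_one G fun x hx y hy =>
    hG.unique_of_triangle htri haC hbC (by simp) hab x (hXs hx) y (hXs hy)
  have hb1 := degIn_le_one G fun x hx y hy =>
    hG.unique_of_triangle htri hbC haC (by simp) hab.symm x (hXs hx) y (hXs hy)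
  have hc1 := degIn_le_one G fun x hx y hy =>
    hG.unique_of_triangle htri hcC haC (by simp) hac.symm x (hXs hx) y (hXs hy)
  have h2 := hX.two_le hC hTn
  have he := hX.even
  rw [Finset.sum_insert (by simp [hab.ne, hac.ne]), Finset.sum_insert (by simp [hbc.ne]),
    Finset.sum_singleton] at h2 he
  obtain ⟨k, hk⟩ := he
  have e1 : ({a, b, c} : Finset V) = {b, c, a} := by ext; simp; tauto
  have e2 : ({a, b, c} : Finset V) = {a, c, b} := by ext; simp; tauto
  rcases Nat.eq_zero_or_pos (degIn G X c) with hc0 | hc0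
  · exact hG.bound_of_two hC hK hab hac hbc htri hX (by omega) (by omega) hc0
  rcases Nat.eq_zero_or_pos (degIn G X b) with hb0 | hb0
  · rw [e2] at htri hX
    exact hG.bound_of_two hC hK hac hab hbc.symm htri hX (by omega) hc0 hb0
  · rw [e1] at htri hX
    exact hG.bound_of_two hC hK hbc hab.symm hac.symm htri hX hb0 hc0 (by omega)

theorem NoClaw.bound_of_triangle (hG : NoClaw G) (C : Finset V) (hC : Conn G C)
    (ht : ∃ a ∈ C, ∃ b ∈ C, ∃ c ∈ C, G.Adj a b ∧ G.Adj a c ∧ G.Adj b c) : Bound G C C.card := by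
  induction C using Finset.strongInduction with
  | H C ih =>
    have hK : ∀ K ⊂ C, Conn G K → Bound G K (K.card - 1) := by
      intro K hKC hKc
      by_cases h : ∃ a ∈ K, ∃ b ∈ K, ∃ c ∈ K, G.Adj a b ∧ G.Adj a c ∧ G.Adj b c
      · exact (ih K hKC hKc h).mono (by linarith)
      · push Not at h
        exact hG.bound_of_triangleFree hKc h
    by_cases h4 : ∀ a ∈ C, ∀ b ∈ C, ∀ c ∈ C, ∀ d ∈ C, G.Adj a b → G.Adj a c → G.Adj a d →
        G.Adj b c → G.Adj b d → ¬ G.Adj c d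
    swap
    · push Not at h4
      obtain ⟨a, ha, b, hb, c, hc, d, hd, hab, hac, had, hbc, hbd, hcd⟩ := h4
      exact hG.bound_of_K4 hC hK ha hb hc hd hab hac had hbc hbd hcd
    by_cases hnd : NoDiamond G C
    swap
    · simp only [NoDiamond] at hnd
      push Not at hnd
      obtain ⟨p, hp, q, hq, x, hx, y, hy, hpq, hpx, hqx, hpy, hqy, hxy⟩ := hnd
      exact hG.bound_of_diamond hC hK h4 hp hq hx hy hpq hpx.symm hqx.symm hpy hqy hxy.symm
    by_cases hdt : NoDisjTri G C
    swap
    · simp only [NoDisjTri] at hdt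
      push Not at hdt
      obtain ⟨x, hx, y, hy, z, hz, u, hu, v, hv, w, hw, hxy, hxz, hyz, huv, huw, hvw, hdis⟩ := hdt
      obtain ⟨C₁, C₂, h1, h2, rfl, hd, c1, c2⟩ := hC.split (T₁ := {x, y, z}) (T₂ := {u, v, w})
        (by simp [Finset.insert_subset_iff, *]) (by simp [Finset.insert_subset_iff, *]) hdis
        (conn_triangle hxy hxz) (conn_triangle huv huw)
      have s1 : C₁ ⊂ C₁ ∪ C₂ := by
        refine Finset.ssubset_iff_of_subset Finset.subset_union_left |>.2
          ⟨u, hu, Finset.disjoint_right.1 hd (h2 (by simp))⟩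
      have s2 : C₂ ⊂ C₁ ∪ C₂ := by
        refine Finset.ssubset_iff_of_subset Finset.subset_union_right |>.2
          ⟨x, hx, Finset.disjoint_left.1 hd (h1 (by simp))⟩
      have b1 := ih C₁ s1 c1 ⟨x, h1 (by simp), y, h1 (by simp), z, h1 (by simp), hxy, hxz, hyz⟩
      have b2 := ih C₂ s2 c2 ⟨u, h2 (by simp), v, h2 (by simp), w, h2 (by simp), huv, huw, hvw⟩
      rw [Finset.card_union_of_disjoint hd, Nat.cast_add]
      exact b1.union b2 hd
    by_cases hbow : ∃ a b c d e, ({a, b, c, d, e} : Finset V) ⊆ C ∧ Bowtie G a b c d e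
    · obtain ⟨a, b, c, d, e, hs, hb⟩ := hbow
      exact hb.bound hG hC hK hnd hdt hs
    obtain ⟨a, ha, b, hb, c, hc, hab, hac, hbc⟩ := ht
    refine hG.bound_of_unique_triangle hC hK ha hb hc hab hac hbc fun u hu x hx y hy hux huy hxy =>
      ?_
    have hmeet := hdt u (Finset.mem_sdiff.1 hu).1 x hx y hy a ha b hb c hc hux huy hxy hab hac hbc
    have key : ∀ a ∈ C, ∀ b ∈ C, ∀ c ∈ C, G.Adj a b → G.Adj a c → G.Adj b c →
        ∀ u ∈ C, ∀ x ∈ C, u ≠ b → u ≠ c → G.Adj u x → G.Adj a u → ¬ G.Adj a x := by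
      intro a ha b hb c hc hab hac hbc u hu x hx hub huc hux hau hax
      have nbx : b ≠ x := fun h => huc (hnd a ha b hb u hu c hc hab hau (h ▸ hux.symm) hac hbc)
      have ncx : c ≠ x := fun h =>
        hub (hnd a ha c hc u hu b hb hac hau (h ▸ hux.symm) hab hbc.symm)
      refine hbow ⟨a, b, c, u, x, by simp [Finset.insert_subset_iff, *], hab, hac, hau, hax, hbc,
        hux, fun h => ?_, fun h => ?_, fun h => ?_, fun h => ?_, hub.symm, nbx, huc.symm, ncx⟩
      · exact huc (hnd a ha b hb u hu c hc hab hau h hac hbc)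
      · exact ncx (hnd a ha b hb c hc x hx hab hac hbc hax h)
      · exact hub (hnd a ha c hc u hu b hb hac hau h hab hbc.symm)
      · exact nbx (hnd a ha c hc b hb x hx hac hab hbc.symm hax h)
    rw [Finset.mem_sdiff] at hu
    simp only [Finset.mem_insert, Finset.mem_singleton, not_or] at hu
    obtain ⟨p, hp, hp'⟩ := Finset.not_disjoint_iff.1 hmeet
    have hpx : ∃ q ∈ C, G.Adj u q ∧ G.Adj p u ∧ G.Adj p q := by
      simp only [Finset.mem_insert, Finset.mem_singleton] at hp hp'
      rcases hp with rfl | rfl | rfl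
      · exact absurd hp' (by simp [hu.2])
      · exact ⟨y, hy, huy, hux.symm, hxy⟩
      · exact ⟨x, hx, hux, huy.symm, hxy.symm⟩
    obtain ⟨q, hq, huq, hpu, hpq⟩ := hpx
    simp only [Finset.mem_insert, Finset.mem_singleton] at hp'
    rcases hp' with rfl | rfl | rfl
    · exact key p ha b hb c hc hab hac hbc u hu.1 q hq hu.2.2.1 hu.2.2.2 huq hpu hpq
    · exact key p hb a ha c hc hab.symm hbc hac u hu.1 q hq hu.2.1 hu.2.2.2 huq hpu hpq
    · exact key p hc a ha b hb hac.symm hbc.symm hab u hu.1 q hq hu.2.1 hu.2.2.1 huq hpu hpq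

theorem conn_univ (hG : G.Connected) : Conn G Finset.univ := by
  obtain ⟨v⟩ := hG.nonempty
  refine ⟨⟨v, Finset.mem_univ v⟩, fun U _ hUn hUn' => ?_⟩
  obtain ⟨x, hx⟩ := hUn
  obtain ⟨y, hy⟩ := hUn'
  obtain ⟨p⟩ := hG.preconnected x y
  obtain ⟨d, -, h1, h2⟩ := p.exists_boundary_dart (U : Set V) (by simpa using hx)
    (by simpa using hy)
  exact ⟨d.fst, by simpa using h1, d.snd, by simpa using h2, d.adj⟩

theorem noClaw_of_isEmpty (h : IsEmpty (completeBipartiteGraph (Fin 1) (Fin 3) ↪g G)) :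
    NoClaw G := by
  intro v x y z hx hy hz hxy hyz hxz
  by_contra hc
  push Not at hc
  obtain ⟨h1, h2, h3⟩ := hc
  set f : Fin 1 ⊕ Fin 3 → V := Sum.elim (fun _ => v) ![x, y, z] with hf
  have hadj : ∀ p q, G.Adj (f p) (f q) ↔ (completeBipartiteGraph (Fin 1) (Fin 3)).Adj p q := by
    rintro (i | i) (j | j)
    · simp [hf]
    · fin_cases j <;> simp [hf, hx, hy, hz]
    · fin_cases i <;> simp [hf, hx.symm, hy.symm, hz.symm]
    · fin_cases i <;> fin_cases j <;> simp [hf, h1, h2, h3, G.adj_comm y x, G.adj_comm z]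
  refine h.false ⟨⟨f, ?_⟩, fun {p q} => hadj p q⟩
  rintro (i | i) (j | j) hij
  · rw [Subsingleton.elim i j]
  · exact absurd ((hadj (.inl i) (.inr j)).2 (by simp)) (hij ▸ G.loopless.irrefl _)
  · exact absurd ((hadj (.inr i) (.inl j)).2 (by simp)) (hij ▸ G.loopless.irrefl _)
  · fin_cases i <;> fin_cases j <;> simp_all

theorem NoClaw.exists_triangle (hG : NoClaw G) (h : 3 ≤ G.maxDegree) :
    ∃ a b c, G.Adj a b ∧ G.Adj a c ∧ G.Adj b c := by
  by_contra hn
  push Not at hn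
  have : G.maxDegree ≤ 2 := G.maxDegree_le_of_forall_degree_le 2 fun v => by
    have := hG.degIn_le_two (C := Finset.univ) (v := v) fun x _ y _ hx hy => hn v x y hx hy
    rwa [degIn, ← SimpleGraph.neighborFinset_eq_filter] at this
  omega

end Main

/-- A connected claw-free graph with maximum degree at least 3 satisfies `s⁺(G) ≥ n`. -/
theorem stmt_0 {V : Type*} [Fintype V] [DecidableEq V] (G : SimpleGraph V) [DecidableRel G.Adj]
    (hconn : G.Connected) (hclaw : ClawFree G) (hdeg : 3 ≤ G.maxDegree) :
    (Fintype.card V : ℝ) ≤ sPlus G := by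
  have hN := noClaw_of_isEmpty hclaw
  obtain ⟨a, b, c, hab, hac, hbc⟩ := hN.exists_triangle hdeg
  let := Classical.decRel G.Adj
  have hB := hN.bound_of_triangle Finset.univ (conn_univ hconn)
    ⟨a, Finset.mem_univ a, b, Finset.mem_univ b, c, Finset.mem_univ c, hab, hac, hbc⟩
  exact le_sum_pos_sq (G.adjMatrix ℝ) (adj_isHermitian G) (Fintype.card V)
    fun N hN' => by simpa using hB N hN'

end SquareEnergy
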